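/- arXiv:1009.3824 — 11 statements merged into one kernel-verified Lean document; each statement's English description precedes it below -/
import Mathlib

section
/- Let P be a probability measure on ℝ^n, and let Q_n (n ∈ ℕ) and Q be observation channels from ℝ^n to ℝ^m. If for P-almost every x the probability measures Q_n(·|x) converge setwise to Q(·|x) (i.e., Q_n(B|x) → Q(B|x) for every Borel set B ⊂ ℝ^m), then the joint measures PQ_n converge setwise to PQ, i.e., PQ_n(A) → PQ(A) for every Borel set A ⊂ ℝ^n × ℝ^m. -/
open MeasureTheory ProbabilityTheory Filter Topology

/-- If `Qₙ(·|x) → Q(·|x)` setwise for `P`-a.e. `x`, then the joint measures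
`P ⊗ₘ Qₙ` converge setwise to `P ⊗ₘ Q`. -/
theorem stmt1 (n m : ℕ) (P : Measure (Fin n → ℝ)) [IsProbabilityMeasure P]
    (Q : ℕ → Kernel (Fin n → ℝ) (Fin m → ℝ)) (Qlim : Kernel (Fin n → ℝ) (Fin m → ℝ))
    [∀ j, IsMarkovKernel (Q j)] [IsMarkovKernel Qlim]
    (h : ∀ᵐ x ∂P, ∀ B : Set (Fin m → ℝ), MeasurableSet B →
      Tendsto (fun j => Q j x B) atTop (𝓝 (Qlim x B))) :
    ∀ A : Set ((Fin n → ℝ) × (Fin m → ℝ)), MeasurableSet A →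
      Tendsto (fun j => (P ⊗ₘ Q j) A) atTop (𝓝 ((P ⊗ₘ Qlim) A)) := by
  intro A hA
  simp_rw [Measure.compProd_apply hA]
  refine tendsto_lintegral_of_dominated_convergence (fun _ => 1)
    (fun j => Kernel.measurable_kernel_prodMk_left hA)
    (fun j => ae_of_all _ fun x => prob_le_one) (by simp) ?_
  filter_upwards [h] with x hx
  exact hx _ (measurable_prodMk_left hA)
end

section
/- Suppose the cost function c : 𝕏 × 𝕌 → ℝ is nonnegative, Borel measurable, bounded, and continuous in u ∈ 𝕌 for every fixed x ∈ 𝕏, and suppose 𝕌 is a compact subset of ℝ^k. Then for any probability measure P on 𝕏 and any observation channel Q from 𝕏 to 𝕐, there exists a Borel measurable policy γ* : 𝕐 → 𝕌 attaining the infimum: ∫ c(x, γ*(y)) PQ(dx,dy) = inf_γ ∫ c(x, γ(y)) PQ(dx,dy), the infimum taken over all Borel measurable γ : 𝕐 → 𝕌. -/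
open MeasureTheory ProbabilityTheory Filter Topology

/-- The infimum over a compact separable space of a function that is continuous in the space
variable and measurable in the parameter is measurable in the parameter. -/
lemma measurable_iInf_of_continuous {X Y : Type*} [TopologicalSpace X] [CompactSpace X]
    [TopologicalSpace.SeparableSpace X] [Nonempty X] [MeasurableSpace Y] {F : Y → X → ℝ}
    (hmeas : ∀ x, Measurable fun y => F y x) (hcont : ∀ y, Continuous (F y)) :
    Measurable fun y => ⨅ x, F y x := by
  have hF : (fun y => ⨅ x, F y x) = fun y => ⨅ i, F y (TopologicalSpace.denseSeq X i) := by
    funext y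
    have hbdd : BddBelow (Set.range (F y)) := (isCompact_range (hcont y)).bddBelow
    apply le_antisymm
    · exact le_ciInf fun i => ciInf_le hbdd _
    · refine le_ciInf fun x => ?_
      refine (TopologicalSpace.denseRange_denseSeq X).induction_on
        (p := fun x => ⨅ i, F y (TopologicalSpace.denseSeq X i) ≤ F y x) x
        (isClosed_le continuous_const (hcont y)) fun i => ?_
      refine ciInf_le (hbdd.mono ?_) i
      rintro _ ⟨j, rfl⟩
      exact ⟨_, rfl⟩
  rw [hF]
  exact Measurable.iInf fun i => hmeas _

lemma exists_eq_iInf_of_continuous {X : Type*} [TopologicalSpace X] [CompactSpace X] [Nonempty X]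
    {f : X → ℝ} (hf : Continuous f) : ∃ x, f x = ⨅ x', f x' := by
  obtain ⟨x, hx⟩ := (isCompact_range hf).sInf_mem (Set.range_nonempty f)
  exact ⟨x, hx⟩

/-- Measurable selection of minimizers over a compact set of reals: the least minimizer is
measurable in the parameter. -/
lemma exists_measurable_argmin_real {Y : Type*} [MeasurableSpace Y] {C : Set ℝ} (hC : IsCompact C)
    (hne : C.Nonempty) {F : Y → C → ℝ} (hmeas : ∀ t, Measurable fun y => F y t)
    (hcont : ∀ y, Continuous (F y)) :
    ∃ γ : Y → C, Measurable γ ∧ ∀ y t, F y (γ y) ≤ F y t := by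
  have : CompactSpace C := isCompact_iff_compactSpace.mp hC
  have : Nonempty C := hne.to_subtype
  let m : Y → ℝ := fun y => ⨅ t, F y t
  have hm : Measurable m := measurable_iInf_of_continuous hmeas hcont
  have hbdd (y : Y) : BddBelow (Set.range (F y)) := (isCompact_range (hcont y)).bddBelow
  have hleast (y : Y) : ∃ t : C, IsLeast {t : C | F y t = m y} t := by
    have hclosed : IsClosed {t : C | F y t = m y} := isClosed_eq (hcont y) continuous_const
    exact hclosed.isCompact.exists_isLeast (exists_eq_iInf_of_continuous (hcont y))
  choose γ hγ using hleast
  refine ⟨γ, ?_, fun y t => (hγ y).1.trans_le (ciInf_le (hbdd y) t)⟩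
  suffices h : Measurable fun y => (γ y : ℝ) from h.subtype_mk
  refine measurable_of_Iic fun a => ?_
  let B : Set C := {t | (t : ℝ) ≤ a}
  have hB : IsClosed B := isClosed_le continuous_subtype_val continuous_const
  obtain hBe | hBne := B.eq_empty_or_nonempty
  · convert MeasurableSet.empty
    refine Set.eq_empty_of_forall_notMem fun y hy => ?_
    exact hBe.le (show γ y ∈ B from hy)
  have : CompactSpace B := isCompact_iff_compactSpace.mp hB.isCompact
  have : Nonempty B := hBne.to_subtype
  have hcontB (y : Y) : Continuous fun t : B => F y t := (hcont y).comp continuous_subtype_val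
  have hmB : Measurable fun y => ⨅ t : B, F y t :=
    measurable_iInf_of_continuous (fun t => hmeas t) hcontB
  convert measurableSet_le hmB hm using 1
  ext y
  constructor
  · intro hy
    exact (ciInf_le (isCompact_range (hcontB y)).bddBelow ⟨γ y, hy⟩).trans (hγ y).1.le
  · intro hy
    obtain ⟨t, ht⟩ := exists_eq_iInf_of_continuous (hcontB y)
    have htm : F y t = m y := le_antisymm (ht.trans_le hy) (ciInf_le (hbdd y) _)
    exact le_trans (Subtype.coe_le_coe.mpr ((hγ y).2 htm)) t.2

/-- Measurable selection of minimizers over a compact metric space. -/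
lemma exists_measurable_argmin {X Y : Type*} [MetricSpace X] [CompactSpace X] [Nonempty X]
    [MeasurableSpace X] [BorelSpace X] [MeasurableSpace Y] {F : Y → X → ℝ}
    (hmeas : ∀ x, Measurable fun y => F y x) (hcont : ∀ y, Continuous (F y)) :
    ∃ γ : Y → X, Measurable γ ∧ ∀ y x, F y (γ y) ≤ F y x := by
  obtain ⟨f, hf, hsurj⟩ := exists_nat_bool_continuous_surjective_of_compact X
  let g : cantorSet → X := f ∘ cantorSetHomeomorphNatToBool
  have hg : Continuous g := hf.comp cantorSetHomeomorphNatToBool.continuous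
  have hg_surj : Function.Surjective g := hsurj.comp cantorSetHomeomorphNatToBool.surjective
  obtain ⟨γ, hγ, hmin⟩ := exists_measurable_argmin_real isCompact_cantorSet
    ⟨0, zero_mem_cantorSet⟩ (F := fun y t => F y (g t)) (fun t => hmeas _)
    (fun y => (hcont y).comp hg)
  refine ⟨g ∘ γ, hg.measurable.comp hγ, fun y x => ?_⟩
  obtain ⟨t, rfl⟩ := hg_surj x
  exact hmin y t

/-- Theorem 2.2: under assumptions A3 (c nonnegative, measurable, bounded, continuous in `u`
for every fixed `x`) and A4 (`𝕌` compact), there exists an optimal control policy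
`γ* : 𝕐 → 𝕌` for any channel `Q`. -/
theorem stmt3 (n m k : ℕ) (U : Set (Fin k → ℝ)) (hUc : IsCompact U) (hUne : U.Nonempty)
    (c : (Fin n → ℝ) → (Fin k → ℝ) → ℝ)
    (hc_nonneg : ∀ x u, 0 ≤ c x u)
    (hc_meas : Measurable fun p : (Fin n → ℝ) × (Fin k → ℝ) => c p.1 p.2)
    (hc_bdd : ∃ C : ℝ, ∀ x u, c x u ≤ C)
    (hc_cont : ∀ x, ContinuousOn (fun u => c x u) U)
    (P : Measure (Fin n → ℝ)) [IsProbabilityMeasure P]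
    (Q : Kernel (Fin n → ℝ) (Fin m → ℝ)) [IsMarkovKernel Q] :
    ∃ γstar : (Fin m → ℝ) → (Fin k → ℝ), Measurable γstar ∧ (∀ y, γstar y ∈ U) ∧
      (∫ z, c z.1 (γstar z.2) ∂(P ⊗ₘ Q)) =
        sInf {r : ℝ | ∃ γ : (Fin m → ℝ) → (Fin k → ℝ), Measurable γ ∧ (∀ y, γ y ∈ U) ∧
          r = ∫ z, c z.1 (γ z.2) ∂(P ⊗ₘ Q)} := by
  obtain ⟨C, hC⟩ := hc_bdd
  have : CompactSpace U := isCompact_iff_compactSpace.mp hUc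
  have : Nonempty U := hUne.to_subtype
  have hc_norm (x : Fin n → ℝ) (u : Fin k → ℝ) : ‖c x u‖ ≤ C := by
    rw [Real.norm_of_nonneg (hc_nonneg x u)]
    exact hC x u
  let ρ : Measure ((Fin m → ℝ) × (Fin n → ℝ)) := (P ⊗ₘ Q).map Prod.swap
  have : IsProbabilityMeasure ρ := Measure.isProbabilityMeasure_map measurable_swap.aemeasurable
  let F : (Fin m → ℝ) → U → ℝ := fun y u => ∫ x, c x u ∂(ρ.condKernel y)
  have hc_meas_left (u : Fin k → ℝ) : Measurable fun x => c x u :=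
    hc_meas.comp measurable_prodMk_right
  have hF_meas (u : U) : Measurable fun y => F y u :=
    ((hc_meas_left u).stronglyMeasurable.integral_kernel (κ := ρ.condKernel)).measurable
  have hF_cont (y : Fin m → ℝ) : Continuous (F y) :=
    continuous_of_dominated (bound := fun _ => C)
      (fun u => (hc_meas_left u).aestronglyMeasurable)
      (fun u => ae_of_all _ fun x => hc_norm x u) (integrable_const C)
      (ae_of_all _ fun x => (hc_cont x).domRestrict)
  have hcγ_meas {γ : (Fin m → ℝ) → (Fin k → ℝ)} (hγ : Measurable γ) :
      Measurable fun z : (Fin m → ℝ) × (Fin n → ℝ) => c z.2 (γ z.1) :=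
    hc_meas.comp (measurable_snd.prodMk (hγ.comp measurable_fst))
  have hcγ_int {γ : (Fin m → ℝ) → (Fin k → ℝ)} (hγ : Measurable γ) :
      Integrable (fun z : (Fin m → ℝ) × (Fin n → ℝ) => c z.2 (γ z.1))
        (ρ.fst ⊗ₘ ρ.condKernel) :=
    .of_bound (hcγ_meas hγ).aestronglyMeasurable C (ae_of_all _ fun z => hc_norm _ _)
  have hcost {γ : (Fin m → ℝ) → (Fin k → ℝ)} (hγ : Measurable γ) :
      ∫ z, c z.1 (γ z.2) ∂(P ⊗ₘ Q) = ∫ y, ∫ x, c x (γ y) ∂(ρ.condKernel y) ∂ρ.fst := by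
    rw [← Measure.integral_compProd (hcγ_int hγ), ρ.disintegrate ρ.condKernel,
      integral_map measurable_swap.aemeasurable (hcγ_meas hγ).aestronglyMeasurable]
    rfl
  obtain ⟨γ₀, hγ₀, hmin⟩ := exists_measurable_argmin hF_meas hF_cont
  have hγ₀_val : Measurable fun y => (γ₀ y : Fin k → ℝ) := measurable_subtype_coe.comp hγ₀
  refine ⟨fun y => γ₀ y, hγ₀_val, fun y => (γ₀ y).2, Eq.symm (IsLeast.csInf_eq ⟨?_, ?_⟩)⟩
  · exact ⟨_, hγ₀_val, fun y => (γ₀ y).2, rfl⟩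
  · rintro _ ⟨γ, hγ, hγU, rfl⟩
    rw [hcost hγ₀_val, hcost hγ]
    exact integral_mono (hcγ_int hγ₀_val).integral_compProd (hcγ_int hγ).integral_compProd
      fun y => hmin y ⟨γ y, hγU y⟩
end

section
/- Let 𝕌 ⊂ ℝ^k be closed and convex, let c : ℝ^n × 𝕌 → ℝ be nonnegative, bounded, and continuous on ℝ^n × 𝕌, and let μ be any probability measure on ℝ^n × ℝ^m. Then the infimum of ∫ c(x, f(y)) μ(dx,dy) over all continuous functions f : ℝ^m → 𝕌 equals the infimum of ∫ c(x, g(y)) μ(dx,dy) over all Borel measurable functions g : ℝ^m → 𝕌. -/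
open MeasureTheory ProbabilityTheory Filter Topology

/-- A simple function with values in a convex set agrees, outside a set of small measure, with a
continuous function with values in that set. -/
theorem exists_continuous_eq_simpleFunc_off_small {Y E : Type*} [TopologicalSpace Y]
    [T2Space Y] [ParacompactSpace Y] [MeasurableSpace Y] [BorelSpace Y]
    [AddCommGroup E] [Module ℝ E] [TopologicalSpace E] [ContinuousAdd E] [ContinuousSMul ℝ E]
    (ν : Measure Y) [IsFiniteMeasure ν] [ν.WeaklyRegular]
    {U : Set E} (hU : Convex ℝ U) (s : SimpleFunc Y E) (hs : ∀ y, s y ∈ U)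
    {ε : ENNReal} (hε : ε ≠ 0) :
    ∃ f : C(Y, E), (∀ y, f y ∈ U) ∧ ∃ B : Set Y, MeasurableSet B ∧ ν B ≤ ε ∧
      ∀ y ∉ B, f y = s y := by
  obtain ⟨δ, hδ, hδε⟩ := ENNReal.exists_pos_sum_of_countable' hε s.range
  have hK : ∀ v : s.range, ∃ K ⊆ s ⁻¹' {v.1}, IsClosed K ∧ ν (s ⁻¹' {v.1} \ K) < δ v :=
    fun v => (s.measurableSet_fiber v.1).exists_isClosed_sdiff_lt (measure_ne_top ν _) (hδ v).ne'
  choose K hKs hKc hKν using hK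
  obtain ⟨f, hf⟩ := exists_continuous_forall_mem_convex_of_local_const
    (t := fun y => U ∩ ⋂ v : s.range, ⋂ _ : y ∈ K v, {v.1})
    (fun y => hU.inter (convex_iInter fun v => convex_iInter fun _ => convex_singleton _))
    (fun y => by
      refine ⟨s y, ?_⟩
      have h : ∀ᶠ z in 𝓝 y, ∀ v : s.range, z ∈ K v → y ∈ K v := by
        refine eventually_all.2 fun v => ?_
        by_cases hy : y ∈ K v
        · exact Eventually.of_forall fun _ _ => hy
        · filter_upwards [(hKc v).isOpen_compl.mem_nhds hy] with z hz hz'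
          exact absurd hz' hz
      filter_upwards [h] with z hz
      exact ⟨hs y, Set.mem_iInter₂.2 fun v hv => hKs v (hz v hv)⟩)
  refine ⟨f, fun y => (hf y).1, ⋃ v : s.range, s ⁻¹' {v.1} \ K v,
    .iUnion fun v => (s.measurableSet_fiber v.1).diff (hKc v).measurableSet, ?_, fun y hy => ?_⟩
  · exact (measure_iUnion_le _).trans ((ENNReal.tsum_le_tsum fun v => (hKν v).le).trans hδε.le)
  · have hyK : y ∈ K ⟨s y, s.mem_range_self y⟩ := by
      by_contra h
      exact hy (Set.mem_iUnion.2 ⟨⟨s y, s.mem_range_self y⟩, rfl, h⟩)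
    exact Set.mem_iInter₂.1 (hf y).2 _ hyK

/-- The cost of a measurable policy with values in `U` is a measurable function. -/
theorem ContinuousOn.measurable_comp_policy {X Y E : Type*}
    [TopologicalSpace X] [SecondCountableTopology X] [MeasurableSpace X] [BorelSpace X]
    [MeasurableSpace Y]
    [TopologicalSpace E] [SecondCountableTopology E] [MeasurableSpace E] [BorelSpace E]
    {U : Set E} {c : X → E → ℝ}
    (hc : ContinuousOn (fun p : X × E => c p.1 p.2) (Set.univ ×ˢ U))
    {g : Y → E} (hg : Measurable g) (hgU : ∀ y, g y ∈ U) :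
    Measurable fun z : X × Y => c z.1 (g z.2) :=
  (continuousOn_iff_continuous_domRestrict.1 hc).measurable.comp
    ((measurable_fst.prodMk (hg.comp measurable_snd)).subtype_mk
      (h := fun z => ⟨Set.mem_univ _, hgU z.2⟩))

/-- The cost of a measurable policy is approximated from above by costs of continuous policies. -/
theorem exists_continuous_policy_integral_le {X Y E : Type*}
    [TopologicalSpace X] [SecondCountableTopology X] [MeasurableSpace X] [BorelSpace X]
    [TopologicalSpace Y] [T2Space Y] [ParacompactSpace Y] [MeasurableSpace Y] [BorelSpace Y]
    [NormedAddCommGroup E] [NormedSpace ℝ E] [SecondCountableTopology E]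
    [MeasurableSpace E] [BorelSpace E]
    {U : Set E} (hU : Convex ℝ U) {c : X → E → ℝ} (hc_nonneg : ∀ x u, 0 ≤ c x u)
    {C : ℝ} (hC : ∀ x u, c x u ≤ C)
    (hc : ContinuousOn (fun p : X × E => c p.1 p.2) (Set.univ ×ˢ U))
    (μ : Measure (X × Y)) [IsFiniteMeasure μ] [μ.snd.WeaklyRegular]
    {g : Y → E} (hg : Measurable g) (hgU : ∀ y, g y ∈ U) {ε : ℝ} (hε : 0 < ε) :
    ∃ f : C(Y, E), (∀ y, f y ∈ U) ∧
      ∫ z, c z.1 (f z.2) ∂μ ≤ ∫ z, c z.1 (g z.2) ∂μ + ε := by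
  rcases isEmpty_or_nonempty Y with hY | ⟨⟨y₀⟩⟩
  · exact ⟨⟨g, continuous_of_const fun y => hY.elim y⟩, hgU, by simp [hε.le]⟩
  rcases isEmpty_or_nonempty X with hX | ⟨⟨x₀⟩⟩
  · exact ⟨.const Y (g y₀), fun _ => hgU y₀, by simp [integral_of_isEmpty, hε.le]⟩
  have hbdd : ∀ x u, ‖c x u‖ ≤ C := fun x u => by
    rw [Real.norm_of_nonneg (hc_nonneg x u)]; exact hC x u
  have hC0 : 0 ≤ C := (hc_nonneg x₀ (g y₀)).trans (hC x₀ (g y₀))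
  have hint : ∀ {h : Y → E}, Measurable h → (∀ y, h y ∈ U) →
      Integrable (fun z : X × Y => c z.1 (h z.2)) μ := fun hh hhU =>
    .of_bound (hc.measurable_comp_policy hh hhU).aestronglyMeasurable C
      (.of_forall fun z => hbdd _ _)
  let s := SimpleFunc.approxOn g hg U (g y₀) (hgU y₀)
  have hsU : ∀ j y, s j y ∈ U := fun j y => SimpleFunc.approxOn_mem hg (hgU y₀) j y
  have hlim : Tendsto (fun j => ∫ z, c z.1 (s j z.2) ∂μ) atTop (𝓝 (∫ z, c z.1 (g z.2) ∂μ)) := by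
    refine tendsto_integral_of_dominated_convergence (fun _ => C)
      (fun j => (hint (s j).measurable (hsU j)).aestronglyMeasurable) (integrable_const C)
      (fun j => .of_forall fun z => hbdd _ _) (.of_forall fun z => ?_)
    refine (hc (z.1, g z.2) ⟨Set.mem_univ _, hgU _⟩).tendsto.comp
      (tendsto_nhdsWithin_iff.2 ⟨tendsto_const_nhds.prodMk_nhds
        (SimpleFunc.tendsto_approxOn hg (hgU y₀) (subset_closure (hgU _))),
        .of_forall fun j => ⟨Set.mem_univ _, hsU j _⟩⟩)
  obtain ⟨j, hj⟩ := (hlim.eventually_lt_const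
    (lt_add_of_pos_right (∫ z, c z.1 (g z.2) ∂μ) (half_pos hε))).exists
  have hδ : 0 < ε / 2 / (C + 1) := by positivity
  obtain ⟨f, hfU, B, hB, hBν, hfB⟩ := exists_continuous_eq_simpleFunc_off_small μ.snd hU (s j)
    (hsU j) (ENNReal.ofReal_pos.2 hδ).ne'
  refine ⟨f, hfU, ?_⟩
  have hB' : MeasurableSet (Prod.snd ⁻¹' B : Set (X × Y)) := measurable_snd hB
  have hreal : μ.real (Prod.snd ⁻¹' B) ≤ ε / 2 / (C + 1) := by
    rw [Measure.snd_apply hB] at hBν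
    exact ENNReal.toReal_le_of_le_ofReal hδ.le hBν
  have hind : Integrable ((Prod.snd ⁻¹' B : Set (X × Y)).indicator fun _ => C) μ :=
    (integrable_const C).indicator hB'
  have hle : ∫ z, c z.1 (f z.2) ∂μ ≤
      ∫ z, c z.1 (s j z.2) ∂μ + μ.real (Prod.snd ⁻¹' B) * C := by
    rw [← smul_eq_mul, ← integral_indicator_const C hB',
      ← integral_add (hint (s j).measurable (hsU j)) hind]
    refine integral_mono (hint f.continuous.measurable hfU)
      ((hint (s j).measurable (hsU j)).add hind) fun z => ?_
    by_cases hz : z.2 ∈ B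
    · simpa [hz] using (hC z.1 (f z.2)).trans (le_add_of_nonneg_left (hc_nonneg z.1 (s j z.2)))
    · simp [hz, hfB z.2 hz]
  have : μ.real (Prod.snd ⁻¹' B) * C ≤ ε / 2 :=
    calc μ.real (Prod.snd ⁻¹' B) * C ≤ ε / 2 / (C + 1) * (C + 1) := by gcongr; linarith
      _ = ε / 2 := by field_simp
  linarith

/-- For a closed convex action set `𝕌`, a nonnegative bounded cost `c` continuous on
`𝕏 × 𝕌`, and any probability measure `μ` on `𝕏 × 𝕐`, the infimum of the cost over
continuous policies equals the infimum over Borel measurable policies. -/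
theorem stmt4 (n m k : ℕ) (U : Set (Fin k → ℝ)) (hU_closed : IsClosed U)
    (hU_convex : Convex ℝ U)
    (c : (Fin n → ℝ) → (Fin k → ℝ) → ℝ)
    (hc_nonneg : ∀ x u, 0 ≤ c x u)
    (hc_bdd : ∃ C : ℝ, ∀ x u, c x u ≤ C)
    (hc_cont : ContinuousOn (fun p : (Fin n → ℝ) × (Fin k → ℝ) => c p.1 p.2)
      (Set.univ ×ˢ U))
    (μ : Measure ((Fin n → ℝ) × (Fin m → ℝ))) [IsProbabilityMeasure μ] :
    sInf {r : ℝ | ∃ f : (Fin m → ℝ) → (Fin k → ℝ), Continuous f ∧ (∀ y, f y ∈ U) ∧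
        r = ∫ z, c z.1 (f z.2) ∂μ} =
      sInf {r : ℝ | ∃ g : (Fin m → ℝ) → (Fin k → ℝ), Measurable g ∧ (∀ y, g y ∈ U) ∧
        r = ∫ z, c z.1 (g z.2) ∂μ} := by
  obtain ⟨C, hC⟩ := hc_bdd
  rcases U.eq_empty_or_nonempty with rfl | ⟨u₀, hu₀⟩
  · simp
  have hbelow : ∀ P : ((Fin m → ℝ) → (Fin k → ℝ)) → Prop,
      BddBelow {r : ℝ | ∃ g, P g ∧ (∀ y, g y ∈ U) ∧ r = ∫ z, c z.1 (g z.2) ∂μ} := by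
    refine fun P => ⟨0, ?_⟩
    rintro _ ⟨g, -, -, rfl⟩
    exact integral_nonneg fun z => hc_nonneg _ _
  apply le_antisymm
  · refine le_csInf ⟨_, fun _ => u₀, measurable_const, fun _ => hu₀, rfl⟩ ?_
    rintro _ ⟨g, hg, hgU, rfl⟩
    refine le_of_forall_pos_le_add fun ε hε => ?_
    obtain ⟨f, hfU, hf⟩ :=
      exists_continuous_policy_integral_le hU_convex hc_nonneg hC hc_cont μ hg hgU hε
    exact (csInf_le (hbelow _) ⟨f, f.continuous, hfU, rfl⟩).trans hf
  · refine csInf_le_csInf (hbelow _) ⟨_, fun _ => u₀, continuous_const, fun _ => hu₀, rfl⟩ ?_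
    rintro _ ⟨f, hf, hfU, rfl⟩
    exact ⟨f, hf.measurable, hfU, rfl⟩
end

section
/- Suppose the cost function c : 𝕏 × 𝕌 → ℝ is nonnegative, bounded, and continuous on 𝕏 × 𝕌, and suppose 𝕌 ⊂ ℝ^k is closed and convex. If {Q_n} is a sequence of observation channels such that PQ_n converges weakly to PQ for a channel Q, then limsup_{n→∞} J(P,Q_n) ≤ J(P,Q); that is, the optimal cost J(P,·) is upper semi-continuous with respect to weak convergence of channels at input P. -/
open MeasureTheory ProbabilityTheory Filter Topology

/-- The optimal single-stage cost `J(P,Q) = inf_γ ∫ c(x,γ(y)) PQ(dx,dy)`, the infimum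
over all Borel measurable policies `γ : 𝕐 → 𝕌`. -/
noncomputable def optCost {n m k : ℕ} (P : Measure (Fin n → ℝ)) (U : Set (Fin k → ℝ))
    (c : (Fin n → ℝ) → (Fin k → ℝ) → ℝ) (Q : Kernel (Fin n → ℝ) (Fin m → ℝ)) : ℝ :=
  sInf {r : ℝ | ∃ γ : (Fin m → ℝ) → (Fin k → ℝ), Measurable γ ∧ (∀ y, γ y ∈ U) ∧
    r = ∫ z, c z.1 (γ z.2) ∂(P ⊗ₘ Q)}

/-- A nonempty closed convex subset of a real Hilbert space is a retract of the whole space. -/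
theorem exists_continuous_retraction_of_innerProductSpace {E : Type*} [NormedAddCommGroup E]
    [InnerProductSpace ℝ E] [CompleteSpace E] {K : Set E} (hne : K.Nonempty)
    (hclosed : IsClosed K) (hconvex : Convex ℝ K) :
    ∃ r : E → E, Continuous r ∧ (∀ x, r x ∈ K) ∧ ∀ x ∈ K, r x = x := by
  choose r hrK hr using exists_norm_eq_iInf_of_complete_convex hne hclosed.isComplete hconvex
  have hinner : ∀ x, ∀ w ∈ K, inner ℝ (x - r x) (w - r x) ≤ 0 := fun x =>
    (norm_eq_iInf_iff_real_inner_le_zero hconvex (hrK x)).1 (hr x)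
  refine ⟨r, ?_, hrK, fun x hx => ?_⟩
  · refine (LipschitzWith.of_dist_le_mul (K := 1) fun x y => ?_).continuous
    rw [NNReal.coe_one, one_mul, dist_eq_norm, dist_eq_norm]
    have h₁ := hinner x (r y) (hrK y)
    have h₂ := hinner y (r x) (hrK x)
    have hsq : ‖r x - r y‖ * ‖r x - r y‖ ≤ inner ℝ (x - y) (r x - r y) := by
      rw [← real_inner_self_eq_norm_mul_norm]
      have hsum : inner ℝ (x - y) (r x - r y) - inner ℝ (r x - r y) (r x - r y) =
          -(inner ℝ (x - r x) (r y - r x) + inner ℝ (y - r y) (r x - r y)) := by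
        simp only [inner_sub_left, inner_sub_right]
        ring
      linarith
    have hcs := hsq.trans (real_inner_le_norm (x - y) (r x - r y))
    rcases (norm_nonneg (r x - r y)).eq_or_lt with h0 | hpos
    · rw [← h0]
      exact norm_nonneg _
    · exact le_of_mul_le_mul_right hcs hpos
  · have h := hinner x x hx
    rw [real_inner_self_nonpos, sub_eq_zero] at h
    exact h.symm

/-- A nonempty closed convex subset of `ℝᵏ` is a retract of the whole space. -/
theorem exists_continuous_retraction_pi {ι : Type*} [Fintype ι] {U : Set (ι → ℝ)}
    (hne : U.Nonempty) (hclosed : IsClosed U) (hconvex : Convex ℝ U) :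
    ∃ r : (ι → ℝ) → (ι → ℝ), Continuous r ∧ (∀ x, r x ∈ U) ∧ ∀ x ∈ U, r x = x := by
  let e := EuclideanSpace.equiv ι ℝ
  obtain ⟨r, hr, hrU, hrid⟩ := exists_continuous_retraction_of_innerProductSpace
    (K := e ⁻¹' U) (hne.preimage e.surjective) (hclosed.preimage e.continuous)
    (hconvex.linear_preimage e.toLinearEquiv.toLinearMap)
  refine ⟨fun x => e (r (e.symm x)), e.continuous.comp (hr.comp e.symm.continuous),
    fun x => hrU _, fun x hx => ?_⟩
  beta_reduce
  rw [hrid (e.symm x) (by simpa using hx), e.apply_symm_apply]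

/-- A measurable function is an almost everywhere limit of a sequence of continuous functions. -/
theorem exists_continuous_seq_tendsto_ae {α E : Type*} [PseudoMetricSpace α]
    [MeasurableSpace α] [BorelSpace α] [NormedAddCommGroup E]
    [NormedSpace ℝ E] [MeasurableSpace E] [BorelSpace E] [SecondCountableTopology E]
    (μ : Measure α) [IsFiniteMeasure μ] {g : α → E} (hg : Measurable g) :
    ∃ f : ℕ → α → E, (∀ i, Continuous (f i)) ∧
      ∀ᵐ x ∂μ, Tendsto (fun i => f i x) atTop (𝓝 (g x)) := by
  let d : α → NNReal := fun x => (1 + ‖g x‖₊)⁻¹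
  have hd : Measurable d := (measurable_const.add hg.nnnorm).inv
  have hd1 : ∀ x, d x ≤ 1 := fun x => inv_le_one_of_one_le₀ (by simp)
  let ν := μ.withDensity fun x => (d x : ENNReal)
  have : IsFiniteMeasure ν := by
    refine isFiniteMeasure_withDensity (ne_top_of_le_ne_top (measure_ne_top μ Set.univ) ?_)
    calc ∫⁻ x, (d x : ENNReal) ∂μ ≤ ∫⁻ _, 1 ∂μ :=
          lintegral_mono fun x => ENNReal.coe_le_one_iff.2 (hd1 x)
      _ = μ Set.univ := lintegral_one
  have hac : μ ≪ ν := withDensity_absolutelyContinuous' hd.coe_nnreal_ennreal.aemeasurable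
    (Eventually.of_forall fun x => by simp [d])
  have hint : Integrable g ν := by
    rw [integrable_withDensity_iff_integrable_smul hd]
    refine Integrable.of_bound (hd.smul hg).aestronglyMeasurable 1
      (Eventually.of_forall fun x => ?_)
    rw [NNReal.smul_def, norm_smul, Real.norm_of_nonneg (NNReal.coe_nonneg _)]
    simp only [d, NNReal.coe_inv, NNReal.coe_add, NNReal.coe_one, coe_nnnorm]
    rw [inv_mul_le_one₀ (by positivity)]
    linarith
  have happrox : ∀ i : ℕ, ∃ f : BoundedContinuousFunction α E,
      eLpNorm (g - (f : α → E)) 1 ν ≤ ((i : ENNReal) + 1)⁻¹ ∧ MemLp f 1 ν := fun i =>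
    (memLp_one_iff_integrable.2 hint).exists_boundedContinuous_eLpNorm_sub_le
      ENNReal.one_ne_top (by simp)
  choose f hf hfLp using happrox
  have hlim : Tendsto (fun i => eLpNorm ((f i : α → E) - g) 1 ν) atTop (𝓝 0) := by
    have h0 : Tendsto (fun i : ℕ => ((i : ENNReal) + 1)⁻¹) atTop (𝓝 0) := by
      simpa using (tendsto_add_atTop_iff_nat 1).2 ENNReal.tendsto_inv_nat_nhds_zero
    refine tendsto_of_tendsto_of_tendsto_of_le_of_le tendsto_const_nhds h0
      (fun _ => zero_le) fun i => ?_
    rw [eLpNorm_sub_comm]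
    exact hf i
  obtain ⟨ns, -, hns⟩ := (tendstoInMeasure_of_tendsto_eLpNorm one_ne_zero
    (fun i => (hfLp i).aestronglyMeasurable) hint.aestronglyMeasurable hlim).exists_seq_tendsto_ae
  exact ⟨fun i => f (ns i), fun i => (f (ns i)).continuous, hac.ae_le hns⟩

/-- Theorem 3.2: under assumptions A1 (c nonnegative, bounded, continuous on `𝕏 × 𝕌`)
and A5 (`𝕌` convex, here closed and convex), if `PQₙ → PQ` weakly then
`limsup_n J(P,Qₙ) ≤ J(P,Q)`: the optimal cost is upper semi-continuous under
weak convergence of channels. -/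
theorem stmt5 (n m k : ℕ) (U : Set (Fin k → ℝ)) (hU_closed : IsClosed U)
    (hU_convex : Convex ℝ U)
    (c : (Fin n → ℝ) → (Fin k → ℝ) → ℝ)
    (hc_nonneg : ∀ x u, 0 ≤ c x u)
    (hc_bdd : ∃ C : ℝ, ∀ x u, c x u ≤ C)
    (hc_cont : ContinuousOn (fun p : (Fin n → ℝ) × (Fin k → ℝ) => c p.1 p.2)
      (Set.univ ×ˢ U))
    (P : Measure (Fin n → ℝ)) [IsProbabilityMeasure P]
    (Q : ℕ → Kernel (Fin n → ℝ) (Fin m → ℝ)) (Qlim : Kernel (Fin n → ℝ) (Fin m → ℝ))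
    [∀ j, IsMarkovKernel (Q j)] [IsMarkovKernel Qlim]
    (hweak : ∀ f : (Fin n → ℝ) × (Fin m → ℝ) → ℝ, Continuous f → (∃ C, ∀ z, |f z| ≤ C) →
      Tendsto (fun j => ∫ z, f z ∂(P ⊗ₘ Q j)) atTop (𝓝 (∫ z, f z ∂(P ⊗ₘ Qlim)))) :
    limsup (fun j => optCost P U c (Q j)) atTop ≤ optCost P U c Qlim := by
  obtain ⟨C, hC⟩ := hc_bdd
  have hC_abs : ∀ x u, |c x u| ≤ C := fun x u => by
    rw [abs_of_nonneg (hc_nonneg x u)]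
    exact hC x u
  have hbelow : ∀ R : Kernel (Fin n → ℝ) (Fin m → ℝ), BddBelow {r : ℝ |
      ∃ γ : (Fin m → ℝ) → (Fin k → ℝ), Measurable γ ∧ (∀ y, γ y ∈ U) ∧
        r = ∫ z, c z.1 (γ z.2) ∂(P ⊗ₘ R)} := by
    refine fun R => ⟨0, ?_⟩
    rintro _ ⟨γ, -, -, rfl⟩
    exact integral_nonneg fun z => hc_nonneg _ _
  have hnonneg : ∀ R : Kernel (Fin n → ℝ) (Fin m → ℝ), 0 ≤ optCost P U c R := by
    refine fun R => Real.sInf_nonneg ?_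
    rintro _ ⟨γ, -, -, rfl⟩
    exact integral_nonneg fun z => hc_nonneg _ _
  rcases U.eq_empty_or_nonempty with rfl | hne
  · simp [optCost]
  obtain ⟨r, hr, hrU, hrid⟩ := exists_continuous_retraction_pi hne hU_closed hU_convex
  refine le_csInf ?_ ?_
  · obtain ⟨u, hu⟩ := hne
    exact ⟨_, fun _ => u, measurable_const, fun _ => hu, rfl⟩
  rintro _ ⟨γ, hγ, hγU, rfl⟩
  obtain ⟨f, hf, hfγ⟩ := exists_continuous_seq_tendsto_ae ((P ⊗ₘ Qlim).map Prod.snd) hγ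
  have hcont : ∀ i, Continuous fun z : (Fin n → ℝ) × (Fin m → ℝ) => c z.1 (r (f i z.2)) :=
    fun i => hc_cont.comp_continuous
      (continuous_fst.prodMk (hr.comp ((hf i).comp continuous_snd))) fun z => ⟨trivial, hrU _⟩
  have hstep : ∀ i, limsup (fun j => optCost P U c (Q j)) atTop ≤
      ∫ z, c z.1 (r (f i z.2)) ∂(P ⊗ₘ Qlim) := by
    intro i
    have hlim := hweak _ (hcont i) ⟨C, fun z => hC_abs _ _⟩
    rw [← hlim.limsup_eq]
    refine limsup_le_limsup (Eventually.of_forall fun j => ?_)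
      (isCoboundedUnder_le_of_le atTop fun j => hnonneg (Q j)) hlim.isBoundedUnder_le
    exact csInf_le (hbelow (Q j))
      ⟨fun y => r (f i y), (hr.comp (hf i)).measurable, fun y => hrU _, rfl⟩
  refine ge_of_tendsto' (tendsto_integral_of_dominated_convergence (fun _ => C)
    (fun i => (hcont i).aestronglyMeasurable) (integrable_const C)
    (fun i => Eventually.of_forall fun z => hC_abs _ _) ?_) hstep
  filter_upwards [ae_of_ae_map measurable_snd.aemeasurable hfγ] with z hz
  have hrz : Tendsto (fun i => r (f i z.2)) atTop (𝓝 (γ z.2)) := by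
    simpa only [hrid _ (hγU z.2), Function.comp_def] using (hr.tendsto (γ z.2)).comp hz
  exact (hc_cont (z.1, γ z.2) ⟨trivial, hγU _⟩).tendsto.comp
    (tendsto_nhdsWithin_of_tendsto_nhds_of_eventually_within _ (tendsto_const_nhds.prodMk_nhds hrz)
      (Eventually.of_forall fun i => ⟨trivial, hrU _⟩))
end

section
/- Suppose the cost function c : 𝕏 × 𝕌 → ℝ is nonnegative, Borel measurable, and bounded. If {Q_n} is a sequence of observation channels such that PQ_n converges setwise to PQ for a channel Q (i.e., PQ_n(A) → PQ(A) for every Borel A ⊂ 𝕏 × 𝕐), then limsup_{n→∞} J(P,Q_n) ≤ J(P,Q); that is, the optimal cost J(P,·) is sequentially upper semi-continuous with respect to setwise convergence of channels at input P. -/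
open MeasureTheory ProbabilityTheory Filter Topology

/-- Setwise convergence of probability measures implies convergence of the integrals of
bounded nonnegative measurable functions. -/
theorem tendsto_integral_of_tendsto_setwise {α : Type*} [MeasurableSpace α]
    {μ : ℕ → Measure α} {ν : Measure α} [∀ j, IsProbabilityMeasure (μ j)]
    [IsProbabilityMeasure ν]
    (h : ∀ A, MeasurableSet A → Tendsto (fun j => μ j A) atTop (𝓝 (ν A)))
    {f : α → ℝ} (hf : Measurable f) (hf0 : ∀ a, 0 ≤ f a) {C : ℝ} (hfC : ∀ a, f a ≤ C) :
    Tendsto (fun j => ∫ a, f a ∂(μ j)) atTop (𝓝 (∫ a, f a ∂ν)) := by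
  have layercake (ρ : Measure α) [IsProbabilityMeasure ρ] :
      ∫ a, f a ∂ρ = ∫ t in Set.Ioc 0 C, ρ.real {a | t ≤ f a} := by
    refine Integrable.integral_eq_integral_Ioc_meas_le ?_ (.of_forall hf0) (.of_forall hfC)
    refine .of_bound hf.aestronglyMeasurable C (.of_forall fun a => ?_)
    rw [Real.norm_of_nonneg (hf0 a)]
    exact hfC a
  simp_rw [layercake]
  refine tendsto_integral_of_dominated_convergence (fun _ => 1) (fun j => ?_) ?_ ?_ ?_
  · refine (Antitone.measurable fun s t hst => ?_).aestronglyMeasurable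
    exact measureReal_mono fun a (ha : t ≤ f a) => hst.trans ha
  · exact integrable_const 1
  · refine fun j => .of_forall fun t => ?_
    rw [Real.norm_of_nonneg measureReal_nonneg]
    exact measureReal_le_one
  · refine .of_forall fun t => ?_
    exact (ENNReal.tendsto_toReal (measure_ne_top _ _)).comp
      (h _ (measurableSet_le measurable_const hf))

/-- Theorem 3.3: under assumption A2 (c nonnegative, measurable, bounded), if
`PQₙ → PQ` setwise then `limsup_n J(P,Qₙ) ≤ J(P,Q)`: the optimal cost is
sequentially upper semi-continuous under setwise convergence of channels. -/
theorem stmt6 (n m k : ℕ) (U : Set (Fin k → ℝ))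
    (c : (Fin n → ℝ) → (Fin k → ℝ) → ℝ)
    (hc_nonneg : ∀ x u, 0 ≤ c x u)
    (hc_meas : Measurable fun p : (Fin n → ℝ) × (Fin k → ℝ) => c p.1 p.2)
    (hc_bdd : ∃ C : ℝ, ∀ x u, c x u ≤ C)
    (P : Measure (Fin n → ℝ)) [IsProbabilityMeasure P]
    (Q : ℕ → Kernel (Fin n → ℝ) (Fin m → ℝ)) (Qlim : Kernel (Fin n → ℝ) (Fin m → ℝ))
    [∀ j, IsMarkovKernel (Q j)] [IsMarkovKernel Qlim]
    (hsetwise : ∀ A : Set ((Fin n → ℝ) × (Fin m → ℝ)), MeasurableSet A →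
      Tendsto (fun j => (P ⊗ₘ Q j) A) atTop (𝓝 ((P ⊗ₘ Qlim) A))) :
    limsup (fun j => optCost P U c (Q j)) atTop ≤ optCost P U c Qlim := by
  obtain ⟨C, hC⟩ := hc_bdd
  rcases U.eq_empty_or_nonempty with rfl | ⟨u, hu⟩
  · have hzero (K : Kernel (Fin n → ℝ) (Fin m → ℝ)) : optCost P ∅ c K = 0 := by
      simp [optCost]
    simp [hzero]
  have optCost_nonneg (K : Kernel (Fin n → ℝ) (Fin m → ℝ)) : 0 ≤ optCost P U c K := by
    refine Real.sInf_nonneg ?_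
    rintro r ⟨γ, -, -, rfl⟩
    exact integral_nonneg fun z => hc_nonneg _ _
  refine le_csInf ⟨_, fun _ => u, measurable_const, fun _ => hu, rfl⟩ ?_
  rintro r ⟨γ, hγ, hγU, rfl⟩
  have hlim := tendsto_integral_of_tendsto_setwise hsetwise
    (f := fun z => c z.1 (γ z.2))
    (hc_meas.comp (measurable_fst.prodMk (hγ.comp measurable_snd)))
    (fun _ => hc_nonneg _ _) (fun _ => hC _ _)
  rw [← hlim.limsup_eq]
  refine limsup_le_limsup (.of_forall fun j => ?_) ?_ hlim.isBoundedUnder_le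
  · refine csInf_le ⟨0, ?_⟩ ⟨γ, hγ, hγU, rfl⟩
    rintro r ⟨γ', -, -, rfl⟩
    exact integral_nonneg fun z => hc_nonneg _ _
  · exact IsCoboundedUnder.of_frequently_ge (a := 0)
      (Frequently.of_forall fun j => optCost_nonneg (Q j))
end

section
/- Suppose the cost function c : 𝕏 × 𝕌 → ℝ is nonnegative, Borel measurable, and bounded with supremum norm ‖c‖_∞. Then for any probability measure P on 𝕏 and any two observation channels Q, Q', |J(P,Q) − J(P,Q')| ≤ ‖c‖_∞ ‖PQ − PQ'‖_TV. Consequently, if PQ_n → PQ in total variation, then J(P,Q_n) → J(P,Q); i.e., the optimal cost J(P,·) is continuous on the set of channels under the topology of total variation at input P. -/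
open MeasureTheory ProbabilityTheory Filter Topology

/-- The total variation distance `‖μ − ν‖_TV = 2 sup_B |μ(B) − ν(B)|`,
the supremum over measurable sets `B`. -/
noncomputable def tvDist {α : Type*} [MeasurableSpace α] (μ ν : Measure α) : ℝ :=
  2 * ⨆ B : {B : Set α // MeasurableSet B}, |(μ B.1).toReal - (ν B.1).toReal|

/-- The setwise differences of two finite measures are bounded above. -/
lemma bddAbove_range_abs_measure_sub {α : Type*} [MeasurableSpace α] (μ ν : Measure α)
    [IsFiniteMeasure μ] [IsFiniteMeasure ν] :
    BddAbove (Set.range fun B : {B : Set α // MeasurableSet B} =>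
      |(μ B.1).toReal - (ν B.1).toReal|) := by
  refine ⟨μ.real Set.univ + ν.real Set.univ, ?_⟩
  rintro _ ⟨B, rfl⟩
  have h₁ : (μ B.1).toReal ≤ μ.real Set.univ := measureReal_mono (Set.subset_univ B.1)
  have h₂ : (ν B.1).toReal ≤ ν.real Set.univ := measureReal_mono (Set.subset_univ B.1)
  have h₃ : 0 ≤ (μ B.1).toReal := ENNReal.toReal_nonneg
  have h₄ : 0 ≤ (ν B.1).toReal := ENNReal.toReal_nonneg
  exact abs_le.2 ⟨by linarith, by linarith⟩

lemma tvDist_comm {α : Type*} [MeasurableSpace α] (μ ν : Measure α) :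
    tvDist μ ν = tvDist ν μ := by
  simp only [tvDist, abs_sub_comm]

lemma abs_measure_sub_le_tvDist {α : Type*} [MeasurableSpace α] (μ ν : Measure α)
    [IsFiniteMeasure μ] [IsFiniteMeasure ν] {B : Set α} (hB : MeasurableSet B) :
    |μ.real B - ν.real B| ≤ tvDist μ ν := by
  have h : |μ.real B - ν.real B| ≤
      ⨆ B : {B : Set α // MeasurableSet B}, |(μ B.1).toReal - (ν B.1).toReal| :=
    le_ciSup (bddAbove_range_abs_measure_sub μ ν) ⟨B, hB⟩
  have h₀ := (abs_nonneg _).trans h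
  unfold tvDist
  linarith

lemma tvDist_nonneg {α : Type*} [MeasurableSpace α] (μ ν : Measure α) : 0 ≤ tvDist μ ν :=
  mul_nonneg zero_le_two (Real.iSup_nonneg fun _ => abs_nonneg _)

/-- Integrals of a function with values in `[0, M]` against two finite measures differ by at most
`M` times the total variation distance. -/
lemma abs_integral_sub_integral_le {α : Type*} [MeasurableSpace α] (μ ν : Measure α)
    [IsFiniteMeasure μ] [IsFiniteMeasure ν] {f : α → ℝ} (hf : Measurable f) {M : ℝ}
    (hM : 0 ≤ M) (h_nonneg : ∀ a, 0 ≤ f a) (h_le : ∀ a, f a ≤ M) :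
    |∫ a, f a ∂μ - ∫ a, f a ∂ν| ≤ M * tvDist μ ν := by
  have h_bdd : ∀ a, ‖f a‖ ≤ M := fun a => by
    rw [Real.norm_of_nonneg (h_nonneg a)]; exact h_le a
  have layer : ∀ ρ : Measure α, IsFiniteMeasure ρ →
      ∫ a, f a ∂ρ = ∫ t in Set.Ioc 0 M, ρ.real {a | t ≤ f a} := fun ρ _ =>
    Integrable.integral_eq_integral_Ioc_meas_le
      (Integrable.of_bound hf.aestronglyMeasurable M (ae_of_all _ h_bdd))
      (ae_of_all _ h_nonneg) (ae_of_all _ h_le)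
  have intble : ∀ ρ : Measure α, IsFiniteMeasure ρ →
      IntegrableOn (fun t => ρ.real {a | t ≤ f a}) (Set.Ioc 0 M) := fun ρ _ => by
    have anti : Antitone fun t => ρ.real {a | t ≤ f a} := fun s t hst =>
      measureReal_mono fun a (ha : t ≤ f a) => hst.trans ha
    exact ((anti.antitoneOn _).integrableOn_isCompact isCompact_Icc).mono_set
      Set.Ioc_subset_Icc_self
  rw [layer μ inferInstance, layer ν inferInstance,
    ← integral_sub (intble μ inferInstance) (intble ν inferInstance)]
  have := norm_setIntegral_le_of_norm_le_const (μ := volume) (s := Set.Ioc 0 M)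
    (f := fun t => μ.real {a | t ≤ f a} - ν.real {a | t ≤ f a}) (C := tvDist μ ν)
    (by simp) (fun t _ => abs_measure_sub_le_tvDist μ ν (measurableSet_le measurable_const hf))
  rwa [Real.volume_real_Ioc_of_le hM, sub_zero, mul_comm] at this

lemma optCost_le_add {n m k : ℕ} {U : Set (Fin k → ℝ)} {c : (Fin n → ℝ) → (Fin k → ℝ) → ℝ}
    (hc_nonneg : ∀ x u, 0 ≤ c x u)
    (hc_meas : Measurable fun p : (Fin n → ℝ) × (Fin k → ℝ) => c p.1 p.2)
    {M : ℝ} (hM : ∀ x u, c x u ≤ M) (P : Measure (Fin n → ℝ)) [IsProbabilityMeasure P]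
    (Q Q' : Kernel (Fin n → ℝ) (Fin m → ℝ)) [IsMarkovKernel Q] [IsMarkovKernel Q'] :
    optCost P U c Q ≤ optCost P U c Q' + M * tvDist (P ⊗ₘ Q) (P ⊗ₘ Q') := by
  have hM₀ : 0 ≤ M := (hc_nonneg 0 0).trans (hM 0 0)
  by_cases h : ∃ γ : (Fin m → ℝ) → (Fin k → ℝ), Measurable γ ∧ ∀ y, γ y ∈ U
  · rw [← sub_le_iff_le_add]
    obtain ⟨γ₀, hγ₀, hγ₀U⟩ := h
    refine le_csInf ⟨_, γ₀, hγ₀, hγ₀U, rfl⟩ ?_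
    rintro _ ⟨γ, hγ, hγU, rfl⟩
    have hle : optCost P U c Q ≤ ∫ z, c z.1 (γ z.2) ∂(P ⊗ₘ Q) := by
      refine csInf_le ⟨0, ?_⟩ ⟨γ, hγ, hγU, rfl⟩
      rintro _ ⟨γ', -, -, rfl⟩
      exact integral_nonneg fun z => hc_nonneg _ _
    have hmeas : Measurable fun z : (Fin n → ℝ) × (Fin m → ℝ) => c z.1 (γ z.2) :=
      hc_meas.comp (measurable_fst.prodMk (hγ.comp measurable_snd))
    have := (abs_le.1 (abs_integral_sub_integral_le (P ⊗ₘ Q) (P ⊗ₘ Q') hmeas hM₀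
      (fun z => hc_nonneg _ _) (fun z => hM _ _))).2
    linarith
  · have hzero : ∀ R : Kernel (Fin n → ℝ) (Fin m → ℝ), optCost P U c R = 0 := fun R => by
      have : {r : ℝ | ∃ γ : (Fin m → ℝ) → (Fin k → ℝ), Measurable γ ∧ (∀ y, γ y ∈ U) ∧
          r = ∫ z, c z.1 (γ z.2) ∂(P ⊗ₘ R)} = ∅ :=
        Set.eq_empty_of_forall_notMem fun _ ⟨γ, hγ, hγU, _⟩ => h ⟨γ, hγ, hγU⟩
      rw [optCost, this, Real.sInf_empty]
    rw [hzero, hzero, zero_add]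
    exact mul_nonneg hM₀ (tvDist_nonneg _ _)

lemma abs_optCost_sub_le {n m k : ℕ} {U : Set (Fin k → ℝ)}
    {c : (Fin n → ℝ) → (Fin k → ℝ) → ℝ} (hc_nonneg : ∀ x u, 0 ≤ c x u)
    (hc_meas : Measurable fun p : (Fin n → ℝ) × (Fin k → ℝ) => c p.1 p.2)
    {M : ℝ} (hM : ∀ x u, c x u ≤ M) (P : Measure (Fin n → ℝ)) [IsProbabilityMeasure P]
    (Q Q' : Kernel (Fin n → ℝ) (Fin m → ℝ)) [IsMarkovKernel Q] [IsMarkovKernel Q'] :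
    |optCost P U c Q - optCost P U c Q'| ≤ M * tvDist (P ⊗ₘ Q) (P ⊗ₘ Q') := by
  have h₁ := optCost_le_add (U := U) hc_nonneg hc_meas hM P Q Q'
  have h₂ := optCost_le_add (U := U) hc_nonneg hc_meas hM P Q' Q
  rw [tvDist_comm] at h₂
  exact abs_le.2 ⟨by linarith, by linarith⟩

/-- Theorem 3.4: under assumption A2 (c nonnegative, measurable, bounded with sup norm
`‖c‖_∞`), we have `|J(P,Q) − J(P,Q')| ≤ ‖c‖_∞ ‖PQ − PQ'‖_TV`; consequently the optimal
cost is continuous in the channel under total variation at input `P`. -/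
theorem stmt7 (n m k : ℕ) (U : Set (Fin k → ℝ))
    (c : (Fin n → ℝ) → (Fin k → ℝ) → ℝ)
    (hc_nonneg : ∀ x u, 0 ≤ c x u)
    (hc_meas : Measurable fun p : (Fin n → ℝ) × (Fin k → ℝ) => c p.1 p.2)
    (hc_bdd : ∃ C : ℝ, ∀ x u, c x u ≤ C)
    (P : Measure (Fin n → ℝ)) [IsProbabilityMeasure P]
    (Q Q' : Kernel (Fin n → ℝ) (Fin m → ℝ)) [IsMarkovKernel Q] [IsMarkovKernel Q']
    (Qs : ℕ → Kernel (Fin n → ℝ) (Fin m → ℝ)) [∀ j, IsMarkovKernel (Qs j)] :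
    |optCost P U c Q - optCost P U c Q'| ≤
        (⨆ p : (Fin n → ℝ) × (Fin k → ℝ), c p.1 p.2) * tvDist (P ⊗ₘ Q) (P ⊗ₘ Q') ∧
      (Tendsto (fun j => tvDist (P ⊗ₘ Qs j) (P ⊗ₘ Q)) atTop (𝓝 0) →
        Tendsto (fun j => optCost P U c (Qs j)) atTop (𝓝 (optCost P U c Q))) := by
  obtain ⟨C, hC⟩ := hc_bdd
  have hM : ∀ x u, c x u ≤ ⨆ p : (Fin n → ℝ) × (Fin k → ℝ), c p.1 p.2 := fun x u =>
    le_ciSup (f := fun p : (Fin n → ℝ) × (Fin k → ℝ) => c p.1 p.2)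
      ⟨C, by rintro _ ⟨p, rfl⟩; exact hC _ _⟩ (x, u)
  refine ⟨abs_optCost_sub_le hc_nonneg hc_meas hM P Q Q', fun h => ?_⟩
  rw [tendsto_iff_dist_tendsto_zero]
  refine squeeze_zero (fun _ => dist_nonneg)
    (fun j => abs_optCost_sub_le hc_nonneg hc_meas hM P (Qs j) Q) ?_
  simpa using h.const_mul (⨆ p : (Fin n → ℝ) × (Fin k → ℝ), c p.1 p.2)
end

section
/- Let ν be a finite Borel measure on 𝕏 × 𝕐 = ℝ^n × ℝ^m and let P be a probability measure on 𝕏. Suppose 𝒬 is a set of observation channels such that PQ(A) ≤ ν(A) for every Borel set A ⊂ 𝕏 × 𝕐 and every Q ∈ 𝒬. Then 𝒬 is setwise precompact at input P: every sequence in 𝒬 has a subsequence {Q_{n_k}} and an observation channel Q such that PQ_{n_k} converges setwise to PQ. -/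
open MeasureTheory ProbabilityTheory Filter Topology

/-- Bounded sequences in a separable real Hilbert space have weakly convergent subsequences. -/
theorem exists_subseq_tendsto_inner_of_norm_le {H : Type*} [NormedAddCommGroup H]
    [InnerProductSpace ℝ H] [CompleteSpace H] [TopologicalSpace.SeparableSpace H]
    (f : ℕ → H) (C : ℝ) (hf : ∀ j, ‖f j‖ ≤ C) :
    ∃ φ : ℕ → ℕ, StrictMono φ ∧ ∃ g : H, ∀ h : H,
      Tendsto (fun i => inner ℝ (f (φ i)) h) atTop (𝓝 (inner ℝ g h)) := by
  obtain ⟨Λ, -, φ, hφ, hlim⟩ := WeakDual.isSeqCompact_closedBall ℝ H 0 C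
    (x := fun j => StrongDual.toWeakDual (InnerProductSpace.toDual ℝ H (f j)))
    (fun j => by simpa using hf j)
  refine ⟨φ, hφ, (InnerProductSpace.toDual ℝ H).symm (WeakDual.toStrongDual Λ), fun h => ?_⟩
  rw [InnerProductSpace.toDual_symm_apply]
  exact ((WeakDual.eval_continuous h).tendsto Λ).comp hlim

/-- A sequence of measures dominated by a finite measure on a countably generated measurable space
has a setwise convergent subsequence. -/
theorem exists_subseq_tendsto_setwise_of_le {Ω : Type*} [MeasurableSpace Ω]
    [MeasurableSpace.CountablyGenerated Ω] (ν : Measure Ω) [IsFiniteMeasure ν]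
    (μ : ℕ → Measure Ω) (hμ : ∀ j, μ j ≤ ν) :
    ∃ φ : ℕ → ℕ, StrictMono φ ∧ ∃ ρ : Measure Ω, ∀ A, MeasurableSet A →
      Tendsto (fun i => μ (φ i) A) atTop (𝓝 (ρ A)) := by
  have hfin : ∀ j, IsFiniteMeasure (μ j) := fun j => isFiniteMeasure_of_le ν (hμ j)
  have hbd : ∀ j, ∀ᵐ x ∂ν, ‖((μ j).rnDeriv ν x).toReal‖ ≤ 1 := fun j => by
    filter_upwards [Measure.rnDeriv_le_one_of_le (hμ j)] with x hx
    rw [Real.norm_of_nonneg ENNReal.toReal_nonneg]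
    exact ENNReal.toReal_le_of_le_ofReal zero_le_one (by simpa using hx)
  have hmem : ∀ j, MemLp (fun x => ((μ j).rnDeriv ν x).toReal) 2 ν := fun j =>
    MemLp.of_bound (Measure.measurable_rnDeriv _ _).ennreal_toReal.aestronglyMeasurable 1 (hbd j)
  have : Fact ((2 : ENNReal) ≠ ⊤) := ⟨ENNReal.ofNat_ne_top⟩
  obtain ⟨φ, hφ, g, hg⟩ := exists_subseq_tendsto_inner_of_norm_le (fun j => (hmem j).toLp) _
    (fun j => Lp.norm_le_of_ae_bound zero_le_one (by
      filter_upwards [(hmem j).coeFn_toLp, hbd j] with x hx hx'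
      rwa [hx]))
  have hlim : ∀ A, MeasurableSet A →
      Tendsto (fun i => (μ (φ i)).real A) atTop (𝓝 (∫ x in A, g x ∂ν)) := fun A hA => by
    have h := hg (indicatorConstLp 2 hA (measure_ne_top ν A) 1)
    simp_rw [real_inner_comm (indicatorConstLp 2 hA (measure_ne_top ν A) (1 : ℝ)),
      L2.inner_indicatorConstLp_one] at h
    refine h.congr fun i => ?_
    rw [← Measure.setIntegral_toReal_rnDeriv (Measure.absolutelyContinuous_of_le (hμ (φ i))) A]
    exact integral_congr_ae (ae_restrict_of_ae (hmem (φ i)).coeFn_toLp)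
  have hint : Integrable g ν := (Lp.memLp g).integrable one_le_two
  have hnn : 0 ≤ᵐ[ν] g := ae_nonneg_of_forall_setIntegral_nonneg hint fun A hA _ =>
    ge_of_tendsto' (hlim A hA) fun _ => measureReal_nonneg
  refine ⟨φ, hφ, ν.withDensity fun x => ENNReal.ofReal (g x), fun A hA => ?_⟩
  rw [withDensity_apply _ hA,
    ← ofReal_integral_eq_lintegral_ofReal hint.restrict (ae_restrict_of_ae hnn)]
  refine (ENNReal.tendsto_ofReal (hlim A hA)).congr fun i => ?_
  exact ofReal_measureReal

/-- Lemma 4.2: if `ν` is a finite measure on `𝕏 × 𝕐` and every channel in a family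
satisfies `PQ ≤ ν`, then the family is setwise precompact at input `P`: every sequence
of such channels admits a subsequence converging setwise at input `P` to some channel. -/
theorem stmt8 (n m : ℕ) (ν : Measure ((Fin n → ℝ) × (Fin m → ℝ))) [IsFiniteMeasure ν]
    (P : Measure (Fin n → ℝ)) [IsProbabilityMeasure P]
    (Qs : ℕ → Kernel (Fin n → ℝ) (Fin m → ℝ)) [∀ j, IsMarkovKernel (Qs j)]
    (hmaj : ∀ j, ∀ A : Set ((Fin n → ℝ) × (Fin m → ℝ)), MeasurableSet A →
      (P ⊗ₘ Qs j) A ≤ ν A) :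
    ∃ φ : ℕ → ℕ, StrictMono φ ∧
      ∃ Q : Kernel (Fin n → ℝ) (Fin m → ℝ), IsMarkovKernel Q ∧
        ∀ A : Set ((Fin n → ℝ) × (Fin m → ℝ)), MeasurableSet A →
          Tendsto (fun i => (P ⊗ₘ Qs (φ i)) A) atTop (𝓝 ((P ⊗ₘ Q) A)) := by
  obtain ⟨φ, hφ, ρ, hρ⟩ := exists_subseq_tendsto_setwise_of_le ν (fun j => P ⊗ₘ Qs j)
    fun j => Measure.le_iff.2 (hmaj j)
  have hfst : ρ.fst = P := by
    ext B hB
    rw [Measure.fst_apply hB]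
    refine tendsto_nhds_unique (hρ _ (measurable_fst hB)) (tendsto_const_nhds.congr fun i => ?_)
    rw [← Measure.fst_apply hB, Measure.fst_compProd]
  have hfin : IsFiniteMeasure ρ := ⟨by
    rw [← Measure.fst_univ, hfst]
    exact measure_lt_top P _⟩
  refine ⟨φ, hφ, ρ.condKernel, inferInstance, fun A hA => ?_⟩
  have hdis : P ⊗ₘ ρ.condKernel = ρ := by
    conv_lhs => rw [← hfst]
    exact ρ.disintegrate ρ.condKernel
  rw [hdis]
  exact hρ A hA
end

section
/- Let P be a probability measure on 𝕏 and let 𝒬 be a set of observation channels that is sequentially compact under setwise convergence at input P (every sequence in 𝒬 has a subsequence {Q_{n_k}} and a channel Q ∈ 𝒬 such that PQ_{n_k} → PQ setwise). Suppose the cost function c : 𝕏 × 𝕌 → ℝ is nonnegative, Borel measurable, and bounded. Then there exists a worst channel in 𝒬, i.e., a channel Q* ∈ 𝒬 attaining sup_{Q ∈ 𝒬} J(P,Q). -/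
open MeasureTheory ProbabilityTheory Filter Topology

/-- Setwise convergence of probability measures implies convergence of the integrals of bounded
nonnegative measurable functions. -/
theorem tendsto_integral_of_setwise {α : Type*} [MeasurableSpace α]
    (μ : ℕ → Measure α) [∀ j, IsProbabilityMeasure (μ j)] (ν : Measure α) [IsProbabilityMeasure ν]
    (h : ∀ A, MeasurableSet A → Tendsto (fun j => μ j A) atTop (𝓝 (ν A)))
    (f : α → ℝ) (hf : Measurable f) (hf0 : ∀ a, 0 ≤ f a) (C : ℝ) (hC : ∀ a, f a ≤ C) :
    Tendsto (fun j => ∫ a, f a ∂(μ j)) atTop (𝓝 (∫ a, f a ∂ν)) := by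
  have layer : ∀ (ρ : Measure α) [IsProbabilityMeasure ρ],
      ∫ a, f a ∂ρ = ∫ t in Set.Ioc 0 C, ρ.real {a | t ≤ f a} := fun ρ _ =>
    Integrable.integral_eq_integral_Ioc_meas_le
      (Integrable.of_bound hf.aestronglyMeasurable C
        (.of_forall fun a => by rw [Real.norm_of_nonneg (hf0 a)]; exact hC a))
      (.of_forall hf0) (.of_forall hC)
  simp_rw [layer]
  refine tendsto_integral_of_dominated_convergence (fun _ => (1 : ℝ)) (fun j => ?_)
    (integrable_const _) (fun j => .of_forall fun t => ?_) (.of_forall fun t => ?_)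
  · have anti : Antitone fun t => (μ j).real {a | t ≤ f a} :=
      fun s t hst => measureReal_mono fun a (ha : t ≤ f a) => hst.trans ha
    exact anti.measurable.aestronglyMeasurable
  · rw [Real.norm_of_nonneg measureReal_nonneg]
    exact measureReal_le_one
  · exact (ENNReal.tendsto_toReal (measure_ne_top _ _)).comp
      (h _ (measurableSet_le measurable_const hf))

/-- The optimal cost is at most the cost of any admissible policy. -/
theorem optCost_le {n m k : ℕ} {P : Measure (Fin n → ℝ)} {U : Set (Fin k → ℝ)}
    {c : (Fin n → ℝ) → (Fin k → ℝ) → ℝ} (hc : ∀ x u, 0 ≤ c x u)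
    (Q : Kernel (Fin n → ℝ) (Fin m → ℝ)) {γ : (Fin m → ℝ) → (Fin k → ℝ)}
    (hγ : Measurable γ) (hγU : ∀ y, γ y ∈ U) :
    optCost P U c Q ≤ ∫ z, c z.1 (γ z.2) ∂(P ⊗ₘ Q) := by
  refine csInf_le ⟨0, ?_⟩ ⟨γ, hγ, hγU, rfl⟩
  rintro _ ⟨γ', -, -, rfl⟩
  exact integral_nonneg fun z => hc _ _

/-- Theorem 4.6 (ii): if the family of channels `𝒬` is sequentially compact under setwise
convergence at input `P` and assumption A2 (c nonnegative, measurable, bounded) holds,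
then there exists a worst channel in `𝒬`, attaining `sup_{Q ∈ 𝒬} J(P,Q)`. -/
theorem stmt11 (n m k : ℕ) {ι : Type*} [Nonempty ι]
    (U : Set (Fin k → ℝ))
    (c : (Fin n → ℝ) → (Fin k → ℝ) → ℝ)
    (hc_nonneg : ∀ x u, 0 ≤ c x u)
    (hc_meas : Measurable fun p : (Fin n → ℝ) × (Fin k → ℝ) => c p.1 p.2)
    (hc_bdd : ∃ C : ℝ, ∀ x u, c x u ≤ C)
    (P : Measure (Fin n → ℝ)) [IsProbabilityMeasure P]
    (Q : ι → Kernel (Fin n → ℝ) (Fin m → ℝ)) [∀ i, IsMarkovKernel (Q i)]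
    (hseqcpt : ∀ s : ℕ → ι, ∃ φ : ℕ → ℕ, StrictMono φ ∧ ∃ i0 : ι,
      ∀ A : Set ((Fin n → ℝ) × (Fin m → ℝ)), MeasurableSet A →
        Tendsto (fun j => (P ⊗ₘ Q (s (φ j))) A) atTop (𝓝 ((P ⊗ₘ Q i0) A))) :
    ∃ istar : ι, ∀ i : ι, optCost P U c (Q i) ≤ optCost P U c (Q istar) := by
  obtain ⟨C, hC⟩ := hc_bdd
  rcases U.eq_empty_or_nonempty with rfl | ⟨u, hu⟩
  · exact ⟨Classical.arbitrary ι, fun i => by simp [optCost]⟩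
  have hbdd : BddAbove (Set.range fun i => optCost P U c (Q i)) := by
    refine ⟨C, ?_⟩
    rintro _ ⟨i, rfl⟩
    refine (optCost_le hc_nonneg (Q i) (measurable_const (a := u)) fun _ => hu).trans ?_
    calc ∫ z, c z.1 u ∂(P ⊗ₘ Q i) ≤ ∫ _, C ∂(P ⊗ₘ Q i) :=
          integral_mono_of_nonneg (.of_forall fun z => hc_nonneg _ _) (integrable_const _)
            (.of_forall fun z => hC _ _)
      _ = C := by simp
  obtain ⟨v, -, hv, hvQ⟩ := exists_seq_tendsto_sSup (Set.range_nonempty _) hbdd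
  choose s hs using hvQ
  obtain ⟨φ, hφ, i₀, hlim⟩ := hseqcpt s
  refine ⟨i₀, fun i => (le_csSup hbdd ⟨i, rfl⟩).trans ?_⟩
  refine le_csInf ⟨_, fun _ => u, measurable_const, fun _ => hu, rfl⟩ ?_
  rintro _ ⟨γ, hγ, hγU, rfl⟩
  refine le_of_tendsto_of_tendsto' (hv.comp hφ.tendsto_atTop)
    (tendsto_integral_of_setwise (fun j => P ⊗ₘ Q (s (φ j))) (P ⊗ₘ Q i₀) hlim
      (fun z => c z.1 (γ z.2))
      (hc_meas.comp (measurable_fst.prodMk (hγ.comp measurable_snd)))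
      (fun _ => hc_nonneg _ _) C fun _ => hC _ _) fun j => ?_
  rw [Function.comp_apply, ← hs (φ j)]
  exact optCost_le hc_nonneg _ hγ hγU
end

section
/- For any M ∈ ℕ and any Markov kernel Q from 𝕏 = ℝ^n to {1,…,M}, there exists a sequence {Q̂_n} of finitely randomized quantizers (elements of the convex hull of 𝒬_D(M)) such that |Q(i|x) − Q̂_n(i|x)| ≤ 2/n for all x ∈ 𝕏 and all i = 1,…,M; in particular, Q̂_n(·|x) converges setwise to Q(·|x) for every x, and hence PQ̂_n → PQ setwise for every input probability measure P on 𝕏. -/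
open MeasureTheory ProbabilityTheory Filter Topology

/-- An `M`-cell quantizer, viewed as a channel from `ℝ^n` to `{1,…,M}`: a kernel `Q`
such that `Q(i|x) = 1_{B_i}(x)` for a Borel measurable partition `B_1,…,B_M` of `ℝ^n`
(some cells may be empty). -/
def IsQuantizer {n M : ℕ} (Q : Kernel (Fin n → ℝ) (Fin M)) : Prop :=
  ∃ B : Fin M → Set (Fin n → ℝ),
    (∀ i, MeasurableSet (B i)) ∧
    Pairwise (Function.onFun Disjoint B) ∧
    (⋃ i, B i) = Set.univ ∧
    ∀ x i, Q x {i} = (B i).indicator (fun _ => (1 : ENNReal)) x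

/-- A finitely randomized quantizer: a finite convex combination of deterministic
`M`-cell quantizers. -/
def IsFRQuantizer {n M : ℕ} (Q : Kernel (Fin n → ℝ) (Fin M)) : Prop :=
  ∃ (N : ℕ) (α : Fin N → ENNReal) (Qs : Fin N → Kernel (Fin n → ℝ) (Fin M)),
    (∑ j, α j = 1) ∧ (∀ j, IsQuantizer (Qs j)) ∧
    ∀ x (A : Set (Fin M)), Q x A = ∑ j, α j * Qs j x A

/-- A finite sequence rising from below `u` to at least `u` crosses `u` in exactly one step. -/
lemma existsUnique_fin_crossing {M : ℕ} {f : ℕ → ℝ} (hf : Monotone f) {u : ℝ}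
    (h0 : f 0 < u) (hM : u ≤ f M) : ∃! i : Fin M, f i < u ∧ u ≤ f (i + 1) := by
  classical
  have hex : ∃ k, u ≤ f k := ⟨M, hM⟩
  obtain ⟨k, hk⟩ : ∃ k, Nat.find hex = k + 1 := by
    refine Nat.exists_eq_succ_of_ne_zero fun h => ?_
    have := Nat.find_spec hex
    rw [h] at this
    exact absurd this (not_le.2 h0)
  have hkM : k < M := by
    have := Nat.find_min' hex hM
    omega
  refine ⟨⟨k, hkM⟩, ⟨not_le.1 (Nat.find_min hex (hk ▸ Nat.lt_succ_self k)), hk ▸ Nat.find_spec hex⟩, ?_⟩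
  rintro i ⟨hi, hi'⟩
  have h1 := Nat.find_min' hex hi'
  have h2 : (i : ℕ) ≤ k := by
    by_contra! h
    have hle : f (k + 1) ≤ f i := hf h
    have hu : u ≤ f (k + 1) := hk ▸ Nat.find_spec hex
    linarith
  ext
  simp only
  omega

/-- The number of grid points `1/N, …, N/N` in `(a, b]` is within one of `N (b - a)`. -/
lemma abs_sub_card_grid_le {N : ℕ} (hN : 0 < N) {a b : ℝ} (ha : 0 ≤ a) (hab : a ≤ b)
    (hb : b ≤ 1) :
    |N * (b - a) - (Finset.univ.filter fun j : Fin N =>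
      a < ((j : ℝ) + 1) / N ∧ ((j : ℝ) + 1) / N ≤ b).card| ≤ 1 := by
  have hN' : (0 : ℝ) < N := by exact_mod_cast hN
  have hNa : 0 ≤ a * N := by positivity
  have hNb : 0 ≤ b * N := mul_nonneg (ha.trans hab) hN'.le
  have hfl : ⌊a * N⌋₊ ≤ ⌊b * N⌋₊ := Nat.floor_mono (by gcongr)
  have hcard : (Finset.univ.filter fun j : Fin N =>
      a < ((j : ℝ) + 1) / N ∧ ((j : ℝ) + 1) / N ≤ b).card = ⌊b * N⌋₊ - ⌊a * N⌋₊ := by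
    rw [← Nat.card_Ioc]
    refine Finset.card_bij (fun j _ => (j : ℕ) + 1) ?_ ?_ ?_
    · intro j hj
      simp only [Finset.mem_filter, Finset.mem_univ, true_and] at hj
      rw [lt_div_iff₀ hN', div_le_iff₀ hN'] at hj
      rw [Finset.mem_Ioc, Nat.floor_lt hNa, Nat.le_floor_iff hNb]
      push_cast
      exact hj
    · intro i _ j _ h
      exact Fin.ext (Nat.succ_injective h)
    · intro m hm
      rw [Finset.mem_Ioc] at hm
      have hmN : m ≤ N := by
        refine hm.2.trans (Nat.floor_le_of_le ?_)
        nlinarith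
      rw [Nat.floor_lt hNa, Nat.le_floor_iff hNb] at hm
      have hm0 : 0 < m := by
        have : (0 : ℝ) < m := hNa.trans_lt hm.1
        exact_mod_cast this
      obtain ⟨k, rfl⟩ := Nat.exists_eq_succ_of_ne_zero hm0.ne'
      refine ⟨⟨k, hmN⟩, ?_, rfl⟩
      simp only [Finset.mem_filter, Finset.mem_univ, true_and]
      rw [lt_div_iff₀ hN', div_le_iff₀ hN']
      push_cast at hm
      exact hm
  rw [hcard, Nat.cast_sub hfl, abs_le]
  have h1 := Nat.floor_le hNa
  have h2 := Nat.lt_floor_add_one (a * N)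
  have h3 := Nat.floor_le hNb
  have h4 := Nat.lt_floor_add_one (b * N)
  constructor <;> linarith

/-- A measurable map into a finite set induces a deterministic quantizer. -/
lemma isQuantizer_deterministic {n M : ℕ} {g : (Fin n → ℝ) → Fin M} (hg : Measurable g) :
    IsQuantizer (Kernel.deterministic g hg) := by
  refine ⟨fun i => g ⁻¹' {i}, fun i => hg (measurableSet_singleton i), ?_, ?_, ?_⟩
  · intro i j hij
    exact Disjoint.preimage g (by simpa using hij)
  · ext x
    simp
  · intro x i
    rw [Kernel.deterministic_apply' hg x (measurableSet_singleton i)]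
    rfl

/-- The uniform mixture of finitely many kernels. -/
noncomputable def uniformMixture {X Y : Type*} [MeasurableSpace X] [MeasurableSpace Y] (N : ℕ)
    (κ : Fin N → Kernel X Y) : Kernel X Y where
  toFun x := ∑ j, (N : ENNReal)⁻¹ • κ j x
  measurable' := by
    refine Measure.measurable_of_measurable_coe _ fun A hA => ?_
    simp only [Measure.finsetSum_apply, Measure.smul_apply, smul_eq_mul]
    exact Finset.univ.measurable_fun_sum fun j _ => ((κ j).measurable_coe hA).const_mul _

lemma uniformMixture_apply {X Y : Type*} [MeasurableSpace X] [MeasurableSpace Y] {N : ℕ}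
    (κ : Fin N → Kernel X Y) (x : X) (A : Set Y) :
    uniformMixture N κ x A = ∑ j, (N : ENNReal)⁻¹ * κ j x A := by
  change (∑ j, (N : ENNReal)⁻¹ • κ j x : Measure Y) A = _
  simp [Measure.finsetSum_apply]

lemma sum_inv_card_eq_one {N : ℕ} (hN : 0 < N) : ∑ _j : Fin N, (N : ENNReal)⁻¹ = 1 := by
  rw [Finset.sum_const, Finset.card_univ, Fintype.card_fin, nsmul_eq_mul]
  exact ENNReal.mul_inv_cancel (by exact_mod_cast hN.ne') (ENNReal.natCast_ne_top N)

/-- Mixtures of `N` quantizers approximate a Markov kernel to within `1 / N`. -/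
lemma exists_isFRQuantizer_abs_sub_le {n M : ℕ} (Q : Kernel (Fin n → ℝ) (Fin M))
    [IsMarkovKernel Q] {N : ℕ} (hN : 0 < N) :
    ∃ R : Kernel (Fin n → ℝ) (Fin M), IsFRQuantizer R ∧ IsMarkovKernel R ∧
      ∀ x i, |(Q x {i}).toReal - (R x {i}).toReal| ≤ 1 / (N : ℝ) := by
  classical
  have hN' : (0 : ℝ) < N := by exact_mod_cast hN
  let F : ℕ → (Fin n → ℝ) → ℝ := fun k x => (Q x).real {l : Fin M | (l : ℕ) < k}
  have hFmeas (k : ℕ) : Measurable (F k) :=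
    (Kernel.measurable_coe Q (Set.toFinite _).measurableSet).ennreal_toReal
  have hFmono (x : Fin n → ℝ) : Monotone fun k => F k x := fun a b hab =>
    measureReal_mono fun l (hl : (l : ℕ) < a) => hl.trans_le hab
  have hF0 (x : Fin n → ℝ) : F 0 x = 0 := by simp [F]
  have hFM (x : Fin n → ℝ) : F M x = 1 := by simp [F]
  have hFsucc (x : Fin n → ℝ) (i : Fin M) : F (i + 1) x - F i x = (Q x {i}).toReal := by
    have hset : {l : Fin M | (l : ℕ) < i + 1} = {l : Fin M | (l : ℕ) < i} ∪ {i} := by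
      ext l
      simp only [Set.mem_ofPred_eq, Set.mem_union, Set.mem_singleton_iff, Fin.ext_iff]
      omega
    simp only [F]
    rw [hset, measureReal_union (by simp) (measurableSet_singleton i), add_sub_cancel_left]
    rfl
  have hgrid (j : Fin N) (x : Fin n → ℝ) :
      ∃! i : Fin M, F i x < ((j : ℝ) + 1) / N ∧ ((j : ℝ) + 1) / N ≤ F (i + 1) x := by
    refine existsUnique_fin_crossing (hFmono x) ?_ ?_
    · simp only [hF0]
      positivity
    · simp only [hFM]
      rw [div_le_one hN']
      exact_mod_cast j.2
  choose g hg hguniq using hgrid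
  have hgiff (j : Fin N) (x : Fin n → ℝ) (i : Fin M) :
      g j x = i ↔ F i x < ((j : ℝ) + 1) / N ∧ ((j : ℝ) + 1) / N ≤ F (i + 1) x :=
    ⟨fun h => h ▸ hg j x, fun h => (hguniq j x i h).symm⟩
  have hgmeas (j : Fin N) : Measurable (g j) := by
    refine measurable_to_countable' fun i => ?_
    have : g j ⁻¹' {i} =
        {x | F i x < ((j : ℝ) + 1) / N} ∩ {x | ((j : ℝ) + 1) / N ≤ F (i + 1) x} := by
      ext x
      exact hgiff j x i
    rw [this]
    exact (measurableSet_lt (hFmeas _) measurable_const).inter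
      (measurableSet_le measurable_const (hFmeas _))
  refine ⟨uniformMixture N fun j => Kernel.deterministic (g j) (hgmeas j), ?_, ?_, ?_⟩
  · exact ⟨N, fun _ => (N : ENNReal)⁻¹, _, sum_inv_card_eq_one hN,
      fun j => isQuantizer_deterministic (hgmeas j), fun x A => uniformMixture_apply _ x A⟩
  · refine ⟨fun x => ⟨?_⟩⟩
    rw [uniformMixture_apply]
    simpa using sum_inv_card_eq_one hN
  · intro x i
    have hR : (uniformMixture N (fun j => Kernel.deterministic (g j) (hgmeas j)) x {i}).toReal =
        (Finset.univ.filter fun j : Fin N => F i x < ((j : ℝ) + 1) / N ∧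
          ((j : ℝ) + 1) / N ≤ F (i + 1) x).card / N := by
      simp_rw [uniformMixture_apply,
        Kernel.deterministic_apply' (hgmeas _) x (measurableSet_singleton i),
        Set.indicator_apply, Set.mem_singleton_iff, hgiff]
      rw [← Finset.mul_sum, Finset.sum_boole, ENNReal.toReal_mul, ENNReal.toReal_inv,
        ENNReal.toReal_natCast, ENNReal.toReal_natCast]
      ring
    have hF1 : F (i + 1) x ≤ 1 := hFM x ▸ hFmono x i.2
    have h := abs_sub_card_grid_le hN (hF0 x ▸ hFmono x (Nat.zero_le i))
      (hFmono x (Nat.le_succ i)) hF1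
    simp only [Nat.succ_eq_add_one] at h
    rw [hR, ← hFsucc x i, le_div_iff₀' hN']
    refine le_of_eq_of_le ?_ h
    rw [← Nat.abs_cast N, ← abs_mul, Nat.abs_cast, mul_sub, mul_div_cancel₀ _ hN'.ne']

/-- Pointwise setwise convergence of Markov kernels implies setwise convergence of the joint
measures. -/
lemma tendsto_compProd_apply {X Y : Type*} [MeasurableSpace X] [MeasurableSpace Y]
    {κ : ℕ → Kernel X Y} {Q : Kernel X Y} [∀ j, IsMarkovKernel (κ j)] [IsMarkovKernel Q]
    (h : ∀ x A, Tendsto (fun j => κ j x A) atTop (𝓝 (Q x A)))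
    (P : Measure X) [IsFiniteMeasure P] {A : Set (X × Y)} (hA : MeasurableSet A) :
    Tendsto (fun j => (P ⊗ₘ κ j) A) atTop (𝓝 ((P ⊗ₘ Q) A)) := by
  simp_rw [Measure.compProd_apply hA]
  refine tendsto_lintegral_of_dominated_convergence (fun _ => 1)
    (fun j => Kernel.measurable_kernel_prodMk_left hA) (fun j => .of_forall fun x => prob_le_one)
    (by simp) (.of_forall fun x => h x _)

/-- Theorem 5.4: any Markov kernel `Q` from `ℝ^n` to `{1,…,M}` is the setwise limit of a
sequence of finitely randomized quantizers `Q̂_j`, with `|Q(i|x) − Q̂_j(i|x)| ≤ 2/j`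
uniformly in `x` and `i`; in particular `P Q̂_j → PQ` setwise at every input `P`. -/
theorem stmt14 (n M : ℕ) (Q : Kernel (Fin n → ℝ) (Fin M)) [IsMarkovKernel Q] :
    ∃ Qhat : ℕ → Kernel (Fin n → ℝ) (Fin M),
      (∀ j, IsFRQuantizer (Qhat j)) ∧
      (∀ j : ℕ, 1 ≤ j → ∀ x i,
        |(Q x {i}).toReal - (Qhat j x {i}).toReal| ≤ 2 / (j : ℝ)) ∧
      (∀ x (A : Set (Fin M)), Tendsto (fun j => Qhat j x A) atTop (𝓝 (Q x A))) ∧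
      ∀ P : Measure (Fin n → ℝ), IsProbabilityMeasure P →
        ∀ A : Set ((Fin n → ℝ) × Fin M), MeasurableSet A →
          Tendsto (fun j => (P ⊗ₘ Qhat j) A) atTop (𝓝 ((P ⊗ₘ Q) A)) := by
  choose R hFR hMarkov hR using fun j : ℕ => exists_isFRQuantizer_abs_sub_le Q (Nat.succ_pos j)
  have hset : ∀ x (A : Set (Fin M)), Tendsto (fun j => R j x A) atTop (𝓝 (Q x A)) := by
    classical
    intro x A
    have hsum (μ : Measure (Fin M)) : μ A = ∑ i ∈ A.toFinset, μ {i} := by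
      rw [sum_measure_singleton, Set.coe_toFinset]
    simp_rw [hsum]
    refine tendsto_finsetSum _ fun i _ => ?_
    rw [← ENNReal.tendsto_toReal_iff (fun j => measure_ne_top _ _) (measure_ne_top _ _)]
    refine tendsto_iff_norm_sub_tendsto_zero.2 <| squeeze_zero (fun j => norm_nonneg _)
      (fun j => ?_) tendsto_one_div_add_atTop_nhds_zero_nat
    rw [Real.norm_eq_abs, abs_sub_comm]
    exact_mod_cast hR j x i
  refine ⟨R, hFR, fun j hj x i => (hR j x i).trans ?_, hset, fun P _ A hA =>
    tendsto_compProd_apply hset P hA⟩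
  have hj' : (0 : ℝ) < j := by exact_mod_cast hj
  gcongr
  · norm_num
  · exact Nat.le_succ j
end

section
/- Let P be a probability measure on 𝕏 = ℝ^n, and let {Q_n} be a sequence of M-cell quantizers in 𝒬_D(M) such that PQ_n converges setwise to PQ for some quantizer Q ∈ 𝒬_D(M). Then the convergence also holds in total variation: ‖PQ_n − PQ‖_TV → 0. Moreover, if B_1^n,…,B_M^n and B_1,…,B_M are the cells of Q_n and Q respectively, then P(B_i^n △ B_i) → 0 for all i = 1,…,M, and ‖PQ_n − PQ‖_TV ≤ Σ_{i=1}^M P(B_i^n △ B_i). -/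
open MeasureTheory ProbabilityTheory Filter Topology

/-- On a rectangle with a singleton second side, the joint measure is the mass of one cell. -/
theorem compProd_prod_singleton_real {α : Type*} [MeasurableSpace α] {M : ℕ}
    (P : Measure α) [IsProbabilityMeasure P] (Q : Kernel α (Fin M)) [IsMarkovKernel Q]
    (B : Fin M → Set α) (hB : ∀ i, MeasurableSet (B i))
    (hQ : ∀ x i, Q x {i} = (B i).indicator (fun _ => (1 : ENNReal)) x)
    {S : Set α} (hS : MeasurableSet S) (i : Fin M) :
    ((P ⊗ₘ Q) (S ×ˢ {i})).toReal = P.real (S ∩ B i) := by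
  rw [Measure.compProd_apply_prod hS (measurableSet_singleton i)]
  simp_rw [hQ]
  rw [lintegral_indicator (hB i), setLIntegral_one, Measure.restrict_apply (hB i),
    Set.inter_comm, Measure.real]

/-- The joint measure of a deterministic quantizer, evaluated section by section. -/
theorem compProd_real_eq_sum_of_cells {α : Type*} [MeasurableSpace α] {M : ℕ}
    (P : Measure α) [IsProbabilityMeasure P] (Q : Kernel α (Fin M)) [IsMarkovKernel Q]
    (B : Fin M → Set α) (hB : ∀ i, MeasurableSet (B i))
    (hQ : ∀ x i, Q x {i} = (B i).indicator (fun _ => (1 : ENNReal)) x)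
    {A : Set (α × Fin M)} (hA : MeasurableSet A) :
    ((P ⊗ₘ Q) A).toReal = ∑ i, P.real ((fun x => (x, i)) ⁻¹' A ∩ B i) := by
  have hsec : ∀ i, MeasurableSet ((fun x => (x, i)) ⁻¹' A) := fun i =>
    (measurable_id.prodMk measurable_const) hA
  have hunion : A = ⋃ i, ((fun x => (x, i)) ⁻¹' A) ×ˢ {i} := by
    ext ⟨x, k⟩
    simp
  have hdisj : Pairwise (Function.onFun Disjoint
      fun i : Fin M => ((fun x => (x, i)) ⁻¹' A) ×ˢ ({i} : Set (Fin M))) := by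
    intro i k hik
    refine Set.disjoint_left.2 ?_
    rintro ⟨x, l⟩ ⟨-, h₁⟩ ⟨-, h₂⟩
    exact hik (h₁.symm.trans h₂)
  conv_lhs => rw [hunion]
  rw [measure_iUnion hdisj fun i => (hsec i).prod (measurableSet_singleton i), tsum_fintype,
    ENNReal.toReal_sum fun i _ => measure_ne_top _ _]
  refine Finset.sum_congr rfl fun i _ => ?_
  exact compProd_prod_singleton_real P Q B hB hQ (hsec i) i

/-- The cells of a finite measurable partition have total mass one. -/
theorem sum_measureReal_cells_eq_one {α ι : Type*} [MeasurableSpace α] [Fintype ι]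
    (P : Measure α) [IsProbabilityMeasure P] {B : ι → Set α} (hB : ∀ i, MeasurableSet (B i))
    (hdisj : Pairwise (Function.onFun Disjoint B)) (hcover : (⋃ i, B i) = Set.univ) :
    ∑ i, P.real (B i) = 1 := by
  rw [← measureReal_iUnion_fintype hdisj hB, hcover, probReal_univ]

theorem measureReal_inter_sub_inter_le {α : Type*} [MeasurableSpace α]
    (P : Measure α) [IsFiniteMeasure P] (S C D : Set α) :
    P.real (S ∩ C) - P.real (S ∩ D) ≤ P.real (C \ D) := by
  have h : P.real (S ∩ C) ≤ P.real ((S ∩ D) ∪ (C \ D)) := by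
    refine measureReal_mono fun x hx => ?_
    by_cases hD : x ∈ D
    · exact Or.inl ⟨hx.1, hD⟩
    · exact Or.inr ⟨hx.2, hD⟩
  linarith [measureReal_union_le (μ := P) (S ∩ D) (C \ D)]

theorem measureReal_symmDiff_eq_add {α : Type*} [MeasurableSpace α]
    (P : Measure α) [IsFiniteMeasure P] {C D : Set α} (hC : MeasurableSet C)
    (hD : MeasurableSet D) :
    P.real (symmDiff C D) = P.real (C \ D) + P.real (D \ C) := by
  rw [Set.symmDiff_def]
  exact measureReal_union disjoint_sdiff_sdiff (hD.diff hC)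

/-- The total variation distance of the joint measures of two quantizers is at most the total
mass of the symmetric differences of their cells. -/
theorem tvDist_compProd_le_sum_symmDiff {α : Type*} [MeasurableSpace α] {M : ℕ}
    (P : Measure α) [IsProbabilityMeasure P]
    (Q R : Kernel α (Fin M)) [IsMarkovKernel Q] [IsMarkovKernel R]
    (B C : Fin M → Set α)
    (hB : ∀ i, MeasurableSet (B i)) (hB_disj : Pairwise (Function.onFun Disjoint B))
    (hB_cover : (⋃ i, B i) = Set.univ)
    (hQ : ∀ x i, Q x {i} = (B i).indicator (fun _ => (1 : ENNReal)) x)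
    (hC : ∀ i, MeasurableSet (C i)) (hC_disj : Pairwise (Function.onFun Disjoint C))
    (hC_cover : (⋃ i, C i) = Set.univ)
    (hR : ∀ x i, R x {i} = (C i).indicator (fun _ => (1 : ENNReal)) x) :
    tvDist (P ⊗ₘ Q) (P ⊗ₘ R) ≤ ∑ i, P.real (symmDiff (B i) (C i)) := by
  have hsum : ∑ i, P.real (symmDiff (B i) (C i))
      = ∑ i, P.real (B i \ C i) + ∑ i, P.real (C i \ B i) := by
    rw [← Finset.sum_add_distrib]
    exact Finset.sum_congr rfl fun i _ => measureReal_symmDiff_eq_add P (hB i) (hC i)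
  have hbalance : ∑ i, P.real (B i \ C i) = ∑ i, P.real (C i \ B i) := by
    have h₁ : ∑ i, P.real (B i \ C i) + ∑ i, P.real (B i ∩ C i) = 1 := by
      rw [← Finset.sum_add_distrib, ← sum_measureReal_cells_eq_one P hB hB_disj hB_cover]
      exact Finset.sum_congr rfl fun i _ => measureReal_sdiff_add_inter (hC i)
    have h₂ : ∑ i, P.real (C i \ B i) + ∑ i, P.real (B i ∩ C i) = 1 := by
      rw [← Finset.sum_add_distrib, ← sum_measureReal_cells_eq_one P hC hC_disj hC_cover]
      refine Finset.sum_congr rfl fun i _ => ?_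
      rw [Set.inter_comm]
      exact measureReal_sdiff_add_inter (hB i)
    linarith
  have hsup : (⨆ A : {A : Set (α × Fin M) // MeasurableSet A},
      |((P ⊗ₘ Q) A.1).toReal - ((P ⊗ₘ R) A.1).toReal|) ≤ ∑ i, P.real (B i \ C i) := by
    have : Nonempty {A : Set (α × Fin M) // MeasurableSet A} := ⟨⟨∅, MeasurableSet.empty⟩⟩
    refine ciSup_le fun A => ?_
    rw [compProd_real_eq_sum_of_cells P Q B hB hQ A.2,
      compProd_real_eq_sum_of_cells P R C hC hR A.2, abs_sub_le_iff]
    constructor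
    · rw [← Finset.sum_sub_distrib]
      exact Finset.sum_le_sum fun i _ => measureReal_inter_sub_inter_le P _ _ _
    · rw [← Finset.sum_sub_distrib, hbalance]
      exact Finset.sum_le_sum fun i _ => measureReal_inter_sub_inter_le P _ _ _
  unfold tvDist
  linarith

/-- Theorem 5.6: if a sequence of `M`-cell quantizers `Qₙ` (with cells `Bᵢⁿ`) converges
setwise at input `P` to a quantizer `Q` (with cells `Bᵢ`), then it also converges in
total variation; moreover `P(Bᵢⁿ △ Bᵢ) → 0` for each `i` and
`‖PQₙ − PQ‖_TV ≤ Σᵢ P(Bᵢⁿ △ Bᵢ)`. -/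
theorem stmt16 (n M : ℕ) (P : Measure (Fin n → ℝ)) [IsProbabilityMeasure P]
    (Qs : ℕ → Kernel (Fin n → ℝ) (Fin M)) [∀ j, IsMarkovKernel (Qs j)]
    (Q : Kernel (Fin n → ℝ) (Fin M)) [IsMarkovKernel Q]
    (Bs : ℕ → Fin M → Set (Fin n → ℝ)) (B : Fin M → Set (Fin n → ℝ))
    (hBs_meas : ∀ j i, MeasurableSet (Bs j i))
    (hBs_disj : ∀ j, Pairwise (Function.onFun Disjoint (Bs j)))
    (hBs_cover : ∀ j, (⋃ i, Bs j i) = Set.univ)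
    (hQs : ∀ j x i, Qs j x {i} = (Bs j i).indicator (fun _ => (1 : ENNReal)) x)
    (hB_meas : ∀ i, MeasurableSet (B i))
    (hB_disj : Pairwise (Function.onFun Disjoint B))
    (hB_cover : (⋃ i, B i) = Set.univ)
    (hQ : ∀ x i, Q x {i} = (B i).indicator (fun _ => (1 : ENNReal)) x)
    (hsetwise : ∀ A : Set ((Fin n → ℝ) × Fin M), MeasurableSet A →
      Tendsto (fun j => (P ⊗ₘ Qs j) A) atTop (𝓝 ((P ⊗ₘ Q) A))) :
    Tendsto (fun j => tvDist (P ⊗ₘ Qs j) (P ⊗ₘ Q)) atTop (𝓝 0) ∧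
    (∀ i, Tendsto (fun j => (P (symmDiff (Bs j i) (B i))).toReal) atTop (𝓝 0)) ∧
    ∀ j, tvDist (P ⊗ₘ Qs j) (P ⊗ₘ Q) ≤ ∑ i, (P (symmDiff (Bs j i) (B i))).toReal := by
  have hcells : ∀ i, Tendsto (fun j => P.real (symmDiff (Bs j i) (B i))) atTop (𝓝 0) := by
    intro i
    have hrect : ∀ S : Set (Fin n → ℝ), MeasurableSet S →
        Tendsto (fun j => P.real (S ∩ Bs j i)) atTop (𝓝 (P.real (S ∩ B i))) := by
      intro S hS
      have h := (ENNReal.tendsto_toReal (measure_ne_top (P ⊗ₘ Q) _)).comp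
        (hsetwise (S ×ˢ {i}) (hS.prod (measurableSet_singleton i)))
      rw [compProd_prod_singleton_real P Q B hB_meas hQ hS i] at h
      exact h.congr fun j =>
        compProd_prod_singleton_real P (Qs j) (Bs j) (hBs_meas j) (hQs j) hS i
    have hin := hrect (B i) (hB_meas i)
    have hout := hrect (B i)ᶜ (hB_meas i).compl
    rw [Set.inter_self] at hin
    rw [Set.compl_inter_self, measureReal_empty] at hout
    have hlim := hout.add (hin.const_sub (P.real (B i)))
    rw [sub_self, add_zero] at hlim
    refine hlim.congr fun j => ?_
    rw [measureReal_symmDiff_eq_add P (hBs_meas j i) (hB_meas i), Set.sdiff_eq_compl_inter]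
    linarith [measureReal_sdiff_add_inter (μ := P) (s := B i) (hBs_meas j i)]
  have hbound : ∀ j, tvDist (P ⊗ₘ Qs j) (P ⊗ₘ Q) ≤ ∑ i, P.real (symmDiff (Bs j i) (B i)) :=
    fun j => tvDist_compProd_le_sum_symmDiff P (Qs j) Q (Bs j) B (hBs_meas j) (hBs_disj j)
      (hBs_cover j) (hQs j) hB_meas hB_disj hB_cover hQ
  refine ⟨?_, hcells, hbound⟩
  have hsum := tendsto_finsetSum Finset.univ fun i _ => hcells i
  rw [Finset.sum_const_zero] at hsum
  exact squeeze_zero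
    (fun j => mul_nonneg zero_le_two (Real.iSup_nonneg fun A => abs_nonneg _)) hbound hsum
end

section
/- Let P be a probability measure on ℝ^n that is absolutely continuous with respect to Lebesgue measure, and suppose the cost function c : 𝕏 × 𝕌 → ℝ is nonnegative, Borel measurable, and bounded. Then there exists an optimal quantizer in 𝒬_C(M): a quantizer Q* ∈ 𝒬_C(M) attaining inf_{Q ∈ 𝒬_C(M)} J(P,Q). -/
open MeasureTheory ProbabilityTheory Filter Topology

/-- An `M`-cell quantizer with convex cells: a kernel `Q` from `ℝ^n` to `{1,…,M}` with
`Q(i|x) = 1_{B_i}(x)` for a Borel measurable partition `B_1,…,B_M` of `ℝ^n` into convex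
sets (some cells may be empty). `𝒬_C(M)` is the set of all such quantizers. -/
def IsConvexQuantizer {n M : ℕ} (Q : Kernel (Fin n → ℝ) (Fin M)) : Prop :=
  ∃ B : Fin M → Set (Fin n → ℝ),
    (∀ i, MeasurableSet (B i)) ∧
    (∀ i, Convex ℝ (B i)) ∧
    Pairwise (Function.onFun Disjoint B) ∧
    (⋃ i, B i) = Set.univ ∧
    ∀ x i, Q x {i} = (B i).indicator (fun _ => (1 : ENNReal)) x

/-- The optimal cost `J(P,Q) = inf_γ Σ_i ∫ c(x,γ(i)) Q(i|x) P(dx)` for a channel with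
finite output alphabet `{1,…,M}`, the infimum over all maps `γ : {1,…,M} → 𝕌`. -/
noncomputable def optCostFin {n k M : ℕ} (P : Measure (Fin n → ℝ)) (U : Set (Fin k → ℝ))
    (c : (Fin n → ℝ) → (Fin k → ℝ) → ℝ) (Q : Kernel (Fin n → ℝ) (Fin M)) : ℝ :=
  sInf {r : ℝ | ∃ γ : Fin M → (Fin k → ℝ), (∀ i, γ i ∈ U) ∧
    r = ∑ i, ∫ x, c x (γ i) * (Q x {i}).toReal ∂P}

/-- In finite dimension, a convex set whose complement is convex is Borel measurable. -/
theorem Convex.measurableSet_of_convex_compl {d : ℕ} {E : Type*} [NormedAddCommGroup E]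
    [NormedSpace ℝ E] [FiniteDimensional ℝ E] [MeasurableSpace E] [BorelSpace E]
    (hd : Module.finrank ℝ E ≤ d) {s : Set E} (hs : Convex ℝ s) (hsc : Convex ℝ sᶜ) :
    MeasurableSet s := by
  induction d generalizing E with
  | zero =>
    have : Subsingleton E := Module.finrank_zero_iff.1 (Nat.le_zero.1 hd)
    exact Set.Subsingleton.measurableSet (Set.subsingleton_of_subsingleton)
  | succ d ih =>
    wlog hint : (interior s).Nonempty generalizing s
    · by_cases hint' : (interior sᶜ).Nonempty
      · have h := this hsc (by rwa [compl_compl]) hint'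
        exact MeasurableSet.compl_iff.1 h
      · exfalso
        rw [Set.not_nonempty_iff_eq_empty] at hint hint'
        have hfr : frontier s = Set.univ := by
          rw [frontier, hint, Set.sdiff_empty, ← compl_compl s, closure_compl, hint',
            Set.compl_empty]
        have h0 := hs.addHaar_frontier (Measure.addHaar : Measure E)
        rw [hfr] at h0
        exact NeZero.ne _ (Measure.measure_univ_eq_zero.1 h0)
    rcases (sᶜ).eq_empty_or_nonempty with hempty | ⟨y, hy⟩
    · rw [Set.compl_empty_iff.1 hempty]
      exact MeasurableSet.univ
    obtain ⟨f, u, hfs, hfsc⟩ := geometric_hahn_banach_open hs.interior isOpen_interior hsc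
      (disjoint_compl_right.mono_left interior_subset)
    obtain ⟨a, ha⟩ := hint
    have hlt : ∀ x, f x < u → x ∈ s := fun x hx => by
      by_contra hxs
      exact absurd (hfsc x hxs) (not_le.2 hx)
    have hle : ∀ x ∈ s, f x ≤ u := by
      have hsub : closure (interior s) ⊆ {x | f x ≤ u} :=
        closure_minimal (fun x hx => (hfs x hx).le) (isClosed_le f.continuous continuous_const)
      intro x hx
      apply hsub
      rw [hs.closure_interior_eq_closure_of_nonempty_interior ⟨a, ha⟩]
      exact subset_closure hx
    have hf : f ≠ 0 := by
      rintro rfl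
      have h1 := hfs a ha
      have h2 := hfsc y hy
      simp only [_root_.zero_apply] at h1 h2
      linarith
    obtain ⟨v, hv⟩ : ∃ v, f v ≠ 0 := by
      by_contra! h
      exact hf (ContinuousLinearMap.ext h)
    let x₀ : E := (u / f v) • v
    have hx₀ : f x₀ = u := by simp [x₀, hv]
    let K : Submodule ℝ E := f.toLinearMap.ker
    have hK : Module.finrank ℝ K ≤ d := by
      have hlt : Module.finrank ℝ K < Module.finrank ℝ E := by
        apply Submodule.finrank_lt
        intro htop
        have : v ∈ K := htop ▸ Submodule.mem_top
        exact hv this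
      omega
    let T : K →ᵃ[ℝ] E := K.subtype.toAffineMap + AffineMap.const ℝ K x₀
    have hT : ∀ w : K, T w = (w : E) + x₀ := fun w => rfl
    have hemb : MeasurableEmbedding T := by
      have h1 : MeasurableEmbedding (Subtype.val : K → E) :=
        MeasurableEmbedding.subtype_coe K.closed_of_finiteDimensional.measurableSet
      exact (measurableEmbedding_addRight x₀).comp h1
    have hmeas : MeasurableSet (T ⁻¹' s) :=
      ih hK (hs.affine_preimage T) (by
        rw [← Set.preimage_compl]
        exact hsc.affine_preimage T)
    have hs_eq : s = {x | f x < u} ∪ T '' (T ⁻¹' s) := by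
      ext x
      constructor
      · intro hx
        rcases (hle x hx).lt_or_eq with h | h
        · exact Or.inl h
        · refine Or.inr ⟨⟨x - x₀, ?_⟩, ?_, ?_⟩
          · simp [K, h, hx₀]
          · simpa [hT] using hx
          · simp [hT]
      · rintro (h | ⟨w, hw, rfl⟩)
        · exact hlt x h
        · exact hw
    rw [hs_eq]
    exact (measurableSet_lt f.continuous.measurable measurable_const).union
      (hemb.measurableSet_image.2 hmeas)

/-- In finite dimension, a map with finite codomain whose fibres are convex is Borel measurable. -/
theorem measurable_of_convex_fibers {E ι : Type*} [NormedAddCommGroup E]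
    [NormedSpace ℝ E] [FiniteDimensional ℝ E] [MeasurableSpace E] [BorelSpace E]
    [Finite ι] [MeasurableSpace ι] {g : E → ι} (hg : ∀ i, Convex ℝ (g ⁻¹' {i})) :
    Measurable g := by
  refine measurable_to_countable' fun i => ?_
  have hsep : ∀ j, ∃ C : Set E, MeasurableSet C ∧ g ⁻¹' {i} ⊆ C ∧ (j ≠ i → g ⁻¹' {j} ⊆ Cᶜ) := by
    intro j
    by_cases hj : j = i
    · exact ⟨Set.univ, MeasurableSet.univ, Set.subset_univ _, fun h => absurd hj h⟩
    · obtain ⟨C, hC, hCc, hi, hjC⟩ := exists_convex_convex_compl_subset (hg i) (hg j)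
        (Disjoint.preimage g (by simpa using Ne.symm hj))
      exact ⟨C, hC.measurableSet_of_convex_compl le_rfl hCc, hi, fun _ => hjC⟩
  choose C hCm hCi hCj using hsep
  have : g ⁻¹' {i} = ⋂ j, C j := by
    refine Set.Subset.antisymm (Set.subset_iInter hCi) fun x hx => ?_
    by_contra hne
    exact hCj (g x) hne rfl (Set.mem_iInter.1 hx (g x))
  rw [this]
  exact MeasurableSet.iInter hCm

/-- Sequential compactness of finite convex partitions: a sequence of finite-valued maps with
convex fibres has a subsequence that is almost everywhere eventually equal to such a map. -/
theorem exists_subseq_ae_eventually_eq_of_convex_fibers {E ι : Type*} [NormedAddCommGroup E]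
    [NormedSpace ℝ E] [FiniteDimensional ℝ E] [MeasurableSpace E] [BorelSpace E]
    [Finite ι] (μ : Measure E) [μ.IsAddHaarMeasure] {f : ℕ → E → ι}
    (hf : ∀ m i, Convex ℝ (f m ⁻¹' {i})) :
    ∃ (g : E → ι) (φ : ℕ → ℕ), (∀ i, Convex ℝ (g ⁻¹' {i})) ∧ StrictMono φ ∧
      ∀ᵐ x ∂μ, ∀ᶠ m in atTop, f (φ m) x = g x := by
  let _ : TopologicalSpace ι := ⊥
  have : DiscreteTopology ι := ⟨rfl⟩
  obtain ⟨D, hDc, hDd⟩ := TopologicalSpace.exists_countable_dense E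
  have : Countable D := hDc.to_subtype
  obtain ⟨l, φ, hφ, hl⟩ := CompactSpace.tendsto_subseq (fun m (x : D) => f m x)
  have hl' : ∀ x : D, ∀ᶠ m in atTop, f (φ m) x = l x := fun x => by
    have := tendsto_pi_nhds.1 hl x
    rw [nhds_discrete, tendsto_pure] at this
    exact this
  have hconv : ∀ (F : Filter ℕ) (i : ι), Convex ℝ {x | ∀ᶠ m in F, f (φ m) x = i} := by
    intro F i x hx y hy a b ha hb hab
    filter_upwards [hx, hy] with m hmx hmy
    exact hf (φ m) i hmx hmy ha hb hab
  have hlim : ∀ x, ∃ i, ∀ᶠ m in (hyperfilter ℕ : Filter ℕ), f (φ m) x = i := fun x => by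
    have := (Ultrafilter.eventually_exists_iff (f := hyperfilter ℕ)
      (P := fun i m => f (φ m) x = i)).1 (Eventually.of_forall fun m => ⟨_, rfl⟩)
    exact this
  choose g hg using hlim
  have hgi : ∀ x i, g x = i ↔ ∀ᶠ m in (hyperfilter ℕ : Filter ℕ), f (φ m) x = i := fun x i => by
    refine ⟨fun h => h ▸ hg x, fun h => ?_⟩
    obtain ⟨m, h1, h2⟩ := ((hg x).and h).exists
    exact h1.symm.trans h2
  refine ⟨g, φ, fun i => ?_, hφ, ?_⟩
  · have : g ⁻¹' {i} = {x | ∀ᶠ m in (hyperfilter ℕ : Filter ℕ), f (φ m) x = i} :=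
      Set.ext fun x => hgi x i
    rw [this]
    exact hconv _ i
  · let A : ι → Set E := fun i => {x | ∀ᶠ m in atTop, f (φ m) x = i}
    have hcover : ⋃ i, closure (A i) = Set.univ := by
      refine Set.univ_subset_iff.1 ?_
      rw [← hDd.closure_eq]
      refine closure_minimal (fun x hx => ?_) (isClosed_iUnion_of_finite fun _ => isClosed_closure)
      exact Set.mem_iUnion.2 ⟨l ⟨x, hx⟩, subset_closure (hl' ⟨x, hx⟩)⟩
    have hfr : ∀ᵐ x ∂μ, ∀ i, x ∉ frontier (A i) :=
      ae_all_iff.2 fun i => measure_eq_zero_iff_ae_notMem.1 ((hconv atTop i).addHaar_frontier μ)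
    filter_upwards [hfr] with x hx
    obtain ⟨i, hi⟩ := Set.mem_iUnion.1 (hcover.symm ▸ Set.mem_univ x : x ∈ ⋃ i, closure (A i))
    have hxi : x ∈ A i := interior_subset (by
      by_contra h
      exact hx i ⟨hi, h⟩)
    have hgx : g x = i := (hgi x i).2 (Nat.hyperfilter_le_atTop hxi)
    rw [hgx]
    exact hxi

/-- The quantizer with label map `g` has convex cells when the fibres of `g` are convex. -/
theorem isConvexQuantizer_deterministic {n M : ℕ} {g : (Fin n → ℝ) → Fin M}
    (hg : ∀ i, Convex ℝ (g ⁻¹' {i})) (hgm : Measurable g) :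
    IsConvexQuantizer (Kernel.deterministic g hgm) := by
  refine ⟨fun i => g ⁻¹' {i}, fun i => hgm (measurableSet_singleton i), hg, fun i j hij => ?_, ?_,
    fun x i => ?_⟩
  · exact Disjoint.preimage g (by simpa using hij)
  · exact Set.eq_univ_of_forall fun x => Set.mem_iUnion.2 ⟨g x, rfl⟩
  · rw [Kernel.deterministic_apply' _ _ (measurableSet_singleton i)]
    rfl

/-- A quantizer with convex cells is given by a label map with convex fibres. -/
theorem IsConvexQuantizer.exists_label {n M : ℕ} {Q : Kernel (Fin n → ℝ) (Fin M)}
    (hQ : IsConvexQuantizer Q) :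
    ∃ f : (Fin n → ℝ) → Fin M, (∀ i, Convex ℝ (f ⁻¹' {i})) ∧
      ∀ hf : Measurable f, Q = Kernel.deterministic f hf := by
  obtain ⟨B, -, hBc, hBd, hBu, hBQ⟩ := hQ
  have hex : ∀ x, ∃ i, x ∈ B i := fun x => Set.mem_iUnion.1 (hBu ▸ Set.mem_univ x)
  choose f hf using hex
  have hfB : ∀ i, f ⁻¹' {i} = B i := fun i => by
    ext x
    refine ⟨fun h => ?_, fun h => ?_⟩
    · rw [← show f x = i from h]
      exact hf x
    · by_contra hne
      exact Set.disjoint_left.1 (hBd hne) (hf x) h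
  refine ⟨f, fun i => (hfB i).symm ▸ hBc i, fun hfm => ?_⟩
  ext x : 1
  refine Measure.ext_of_singleton fun i => ?_
  rw [hBQ, Kernel.deterministic_apply' _ _ (measurableSet_singleton i), ← hfB]
  rfl

theorem optCostFin_nonneg {n k M : ℕ} {P : Measure (Fin n → ℝ)} {U : Set (Fin k → ℝ)}
    {c : (Fin n → ℝ) → (Fin k → ℝ) → ℝ} (hc : ∀ x u, 0 ≤ c x u)
    (Q : Kernel (Fin n → ℝ) (Fin M)) : 0 ≤ optCostFin P U c Q := by
  refine Real.sInf_nonneg ?_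
  rintro _ ⟨γ, -, rfl⟩
  exact Finset.sum_nonneg fun i _ =>
    integral_nonneg fun x => mul_nonneg (hc _ _) ENNReal.toReal_nonneg

theorem sum_integral_mul_deterministic {n k M : ℕ} {P : Measure (Fin n → ℝ)}
    [IsFiniteMeasure P] {c : (Fin n → ℝ) → (Fin k → ℝ) → ℝ} (hc_nonneg : ∀ x u, 0 ≤ c x u)
    (hc_meas : Measurable fun p : (Fin n → ℝ) × (Fin k → ℝ) => c p.1 p.2)
    {C : ℝ} (hC : ∀ x u, c x u ≤ C) {f : (Fin n → ℝ) → Fin M} (hf : Measurable f)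
    (γ : Fin M → Fin k → ℝ) :
    ∑ i, ∫ x, c x (γ i) * (Kernel.deterministic f hf x {i}).toReal ∂P =
      ∫ x, c x (γ (f x)) ∂P := by
  have hind : ∀ i x, c x (γ i) * (Kernel.deterministic f hf x {i}).toReal =
      (f ⁻¹' {i}).indicator (fun x => c x (γ i)) x := fun i x => by
    rw [Kernel.deterministic_apply' _ _ (measurableSet_singleton i)]
    by_cases h : f x = i <;> simp [h]
  simp_rw [hind]
  rw [← integral_finsetSum]
  · refine integral_congr_ae (Eventually.of_forall fun x => ?_)
    refine (Finset.sum_eq_single (f x) (fun i _ hi => ?_) (by simp)).trans (by simp)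
    exact Set.indicator_of_notMem (fun h => hi h.symm) _
  · intro i _
    refine Integrable.indicator ?_ (hf (measurableSet_singleton i))
    refine Integrable.of_bound
      (hc_meas.comp (measurable_id.prodMk measurable_const)).aestronglyMeasurable C
      (Eventually.of_forall fun x => ?_)
    simpa [abs_of_nonneg (hc_nonneg x (γ i))] using hC x (γ i)

/-- Changing the label map of a quantizer costs at most the bound on the cost function times the
probability that the labels differ. -/
theorem optCostFin_deterministic_le {n k M : ℕ} {P : Measure (Fin n → ℝ)} [IsFiniteMeasure P]
    {U : Set (Fin k → ℝ)} {c : (Fin n → ℝ) → (Fin k → ℝ) → ℝ} (hc_nonneg : ∀ x u, 0 ≤ c x u)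
    (hc_meas : Measurable fun p : (Fin n → ℝ) × (Fin k → ℝ) => c p.1 p.2)
    {C : ℝ} (hC : ∀ x u, c x u ≤ C) {f g : (Fin n → ℝ) → Fin M} (hf : Measurable f)
    (hg : Measurable g) :
    optCostFin P U c (Kernel.deterministic g hg) ≤
      optCostFin P U c (Kernel.deterministic f hf) + C * P.real {x | f x ≠ g x} := by
  have hC0 : 0 ≤ C := (hc_nonneg 0 0).trans (hC 0 0)
  have hne : MeasurableSet {x | f x ≠ g x} := (measurableSet_eq_fun hf hg).compl
  have hint : ∀ {h : (Fin n → ℝ) → Fin M}, Measurable h → ∀ γ : Fin M → Fin k → ℝ,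
      Integrable (fun x => c x (γ (h x))) P := fun {h} hh γ => by
    refine Integrable.of_bound
      (hc_meas.comp (measurable_id.prodMk ((measurable_of_finite γ).comp hh))).aestronglyMeasurable
      C (Eventually.of_forall fun x => ?_)
    simpa [abs_of_nonneg (hc_nonneg x (γ (h x)))] using hC x (γ (h x))
  rcases U.eq_empty_or_nonempty with rfl | ⟨u, hu⟩
  · rcases M.eq_zero_or_pos with rfl | hM
    · exact (f 0).elim0
    · have : ∀ Q : Kernel (Fin n → ℝ) (Fin M), optCostFin P ∅ c Q = 0 := fun Q => by
        have hemp : ∀ γ : Fin M → Fin k → ℝ, ¬ ∀ i, γ i ∈ (∅ : Set (Fin k → ℝ)) :=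
          fun γ h => h ⟨0, hM⟩
        simp only [optCostFin, hemp, false_and, exists_false, Set.ofPred_false, Real.sInf_empty]
      rw [this, this, zero_add]
      exact mul_nonneg hC0 measureReal_nonneg
  · rw [← sub_le_iff_le_add]
    refine le_csInf ⟨_, fun _ => u, fun _ => hu, rfl⟩ ?_
    rintro _ ⟨γ, hγ, rfl⟩
    rw [sub_le_iff_le_add]
    unfold optCostFin
    refine le_trans (csInf_le ?_ ⟨γ, hγ, rfl⟩) ?_
    · refine ⟨0, ?_⟩
      rintro _ ⟨γ', -, rfl⟩
      exact Finset.sum_nonneg fun i _ =>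
        integral_nonneg fun x => mul_nonneg (hc_nonneg _ _) ENNReal.toReal_nonneg
    · rw [sum_integral_mul_deterministic hc_nonneg hc_meas hC,
        sum_integral_mul_deterministic hc_nonneg hc_meas hC]
      have hind : Integrable ({x | f x ≠ g x}.indicator fun _ => C) P :=
        (integrable_const C).indicator hne
      calc ∫ x, c x (γ (g x)) ∂P
          ≤ ∫ x, (c x (γ (f x)) + {x | f x ≠ g x}.indicator (fun _ => C) x) ∂P := by
            refine integral_mono (hint hg γ) ((hint hf γ).add hind) fun x => ?_
            by_cases h : f x = g x
            · simp [h]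
            · have h1 := hC x (γ (g x))
              have h2 := hc_nonneg x (γ (f x))
              simp only [Set.indicator_apply, Set.mem_ofPred_eq, ne_eq, h, not_false_eq_true,
                if_true]
              linarith
        _ = ∫ x, c x (γ (f x)) ∂P + C * P.real {x | f x ≠ g x} := by
            rw [integral_add (hint hf γ) hind, integral_indicator_const _ hne, smul_eq_mul,
              mul_comm]

/-- If a sequence of finite-valued maps is almost everywhere eventually equal to `g`, the measure
of the set where it differs from `g` tends to zero. -/
theorem tendsto_measureReal_ne_of_ae_eventually_eq {α ι : Type*} [MeasurableSpace α]
    [MeasurableSpace ι] [Countable ι] [MeasurableSingletonClass ι] {μ : Measure α}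
    [IsFiniteMeasure μ] {f : ℕ → α → ι} {g : α → ι} (hf : ∀ m, Measurable (f m))
    (hg : Measurable g) (h : ∀ᵐ x ∂μ, ∀ᶠ m in atTop, f m x = g x) :
    Tendsto (fun m => μ.real {x | f m x ≠ g x}) atTop (𝓝 0) := by
  have hne : ∀ m, MeasurableSet {x | f m x ≠ g x} := fun m =>
    (measurableSet_eq_fun (hf m) hg).compl
  have key := tendsto_integral_of_dominated_convergence (μ := μ)
    (F := fun m => {x | f m x ≠ g x}.indicator (1 : α → ℝ)) (f := fun _ => 0) (fun _ => 1)
    (fun m => (measurable_one.indicator (hne m)).aestronglyMeasurable) (integrable_const 1)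
    (fun m => Eventually.of_forall fun x => by
      by_cases hx : f m x = g x <;> simp [hx])
    (by
      filter_upwards [h] with x hx
      refine tendsto_const_nhds.congr' ?_
      filter_upwards [hx] with m hm
      simp [hm])
  simpa [integral_indicator_one (hne _)] using key

/-- Theorem 5.8: if `P` is absolutely continuous with respect to Lebesgue measure and
assumption A2 holds (c nonnegative, measurable, bounded), then an optimal quantizer
with convex cells exists: some `Q* ∈ 𝒬_C(M)` attains `inf_{Q ∈ 𝒬_C(M)} J(P,Q)`. -/
theorem stmt18 (n k M : ℕ) (hM : 0 < M) (U : Set (Fin k → ℝ))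
    (c : (Fin n → ℝ) → (Fin k → ℝ) → ℝ)
    (hc_nonneg : ∀ x u, 0 ≤ c x u)
    (hc_meas : Measurable fun p : (Fin n → ℝ) × (Fin k → ℝ) => c p.1 p.2)
    (hc_bdd : ∃ C : ℝ, ∀ x u, c x u ≤ C)
    (P : Measure (Fin n → ℝ)) [IsProbabilityMeasure P]
    (habs : P ≪ volume) :
    ∃ Qstar : Kernel (Fin n → ℝ) (Fin M), IsConvexQuantizer Qstar ∧
      ∀ Q : Kernel (Fin n → ℝ) (Fin M), IsConvexQuantizer Q →
        optCostFin P U c Qstar ≤ optCostFin P U c Q := by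
  obtain ⟨C, hC⟩ := hc_bdd
  let J : Set ℝ := optCostFin P U c '' {Q : Kernel (Fin n → ℝ) (Fin M) | IsConvexQuantizer Q}
  have hJb : BddBelow J := ⟨0, by
    rintro _ ⟨Q, -, rfl⟩
    exact optCostFin_nonneg hc_nonneg Q⟩
  have hJne : J.Nonempty := by
    have hconst : ∀ i, Convex ℝ ((fun _ : Fin n → ℝ => (⟨0, hM⟩ : Fin M)) ⁻¹' {i}) := fun i => by
      by_cases h : (⟨0, hM⟩ : Fin M) = i
      · simpa [h] using convex_univ
      · simpa [h] using convex_empty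
    exact ⟨_, _, isConvexQuantizer_deterministic hconst measurable_const, rfl⟩
  obtain ⟨v, -, hv, hvJ⟩ := exists_seq_tendsto_sInf hJne hJb
  choose Q hQ hQv using hvJ
  choose f hf hfQ using fun m => (hQ m).exists_label
  obtain ⟨g, φ, hg, hφ, hlim⟩ := exists_subseq_ae_eventually_eq_of_convex_fibers volume hf
  have hgm : Measurable g := measurable_of_convex_fibers hg
  have hfm : ∀ m, Measurable (f m) := fun m => measurable_of_convex_fibers (hf m)
  refine ⟨Kernel.deterministic g hgm, isConvexQuantizer_deterministic hg hgm, fun Q' hQ' => ?_⟩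
  refine le_trans ?_ (csInf_le hJb ⟨Q', hQ', rfl⟩)
  have hdiff : Tendsto (fun m => P.real {x | f (φ m) x ≠ g x}) atTop (𝓝 0) :=
    tendsto_measureReal_ne_of_ae_eventually_eq (fun m => hfm (φ m)) hgm (habs.ae_le hlim)
  have hupper : Tendsto (fun m => v (φ m) + C * P.real {x | f (φ m) x ≠ g x}) atTop
      (𝓝 (sInf J)) := by
    simpa using (hv.comp hφ.tendsto_atTop).add (hdiff.const_mul C)
  refine ge_of_tendsto' hupper fun m => ?_
  rw [← hQv (φ m), hfQ (φ m) (hfm (φ m))]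
  exact optCostFin_deterministic_le hc_nonneg hc_meas hC (hfm (φ m)) hgm
end
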